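/- A parameter-dependent summation relating vs, sk-type evaluations and hs: for all partitions λ, ν, Σ_μ ((a)_μ/(at)_μ) (−1)^{|λ|−|μ|} vs_{λ/μ}(q,t) Q_{μ/ν}((1−qt)/(1−t)) = ((a)_ν (a/q)_λ)/((a/q)_ν (at)_λ) · q^{|λ|−|ν|} hs_{λ/ν}(q,t), as an identity of rational functions in q, t, a, where the sum is over all partitions μ with ν ⊆ μ ⊆ λ. -/

import Mathlib

/-!
Common framework: integer partitions, Gaussian binomials, Hall--Littlewood
Pieri coefficients, the ring of symmetric functions realized as polynomials
in the power sums, the Macdonald `(q,t)`-inner product, a characterisation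
of the Macdonald polynomials `P_λ(X;q,t)`, skew Macdonald polynomials,
plethystic evaluations and the various Pieri coefficients of
Konvalinka--Lauve and Warnaar.
-/

open scoped BigOperators

noncomputable section

namespace SkewPieriFormalization

/-- An integer partition, encoded as a finitely supported weakly decreasing
sequence of natural numbers; `part j` is the part `λ_{j+1}` (0-indexed). -/
structure Partition where
  part : ℕ →₀ ℕ
  antitone' : ∀ ⦃i j : ℕ⦄, i ≤ j → part j ≤ part i

namespace Partition

/-- Containment of Young diagrams: `μ ≤ λ` iff `μ_i ≤ λ_i` for all `i`. -/
instance : LE Partition := ⟨fun mu lam => ∀ j : ℕ, mu.part j ≤ lam.part j⟩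

/-- `|λ|`, the size (sum of the parts). -/
def size (lam : Partition) : ℕ := lam.part.sum fun _ k => k

/-- `l(λ)`, the number of (nonzero) parts. -/
def length (lam : Partition) : ℕ := lam.part.support.card

/-- `n(λ) = ∑_{i ≥ 1} (i-1) λ_i`. -/
def nstat (lam : Partition) : ℕ := lam.part.sum fun j k => j * k

/-- the `i`-th part `λ_i` (1-indexed). -/
def row (lam : Partition) (i : ℕ) : ℕ := lam.part (i - 1)

/-- the part `λ'_i = #{j : λ_j ≥ i}` of the conjugate partition (for `i ≥ 1`). -/
def conj (lam : Partition) (i : ℕ) : ℕ :=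
  (lam.part.support.filter fun j => i ≤ lam.part j).card

/-- the multiplicity `m_r(λ)` of `r` as a part of `λ`. -/
def mult (lam : Partition) (r : ℕ) : ℕ :=
  (lam.part.support.filter fun j => lam.part j = r).card

/-- `z_λ = ∏_{r ≥ 1} r^{m_r} m_r!`. -/
def zee (lam : Partition) : ℕ :=
  ∏ r ∈ Finset.Icc 1 (lam.part 0), r ^ lam.mult r * Nat.factorial (lam.mult r)

/-- the partial sum `λ_1 + ⋯ + λ_k`. -/
def psum (lam : Partition) (k : ℕ) : ℕ := ∑ j ∈ Finset.range k, lam.part j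

/-- dominance order: `λ ⊵ μ` (for `|λ| = |μ|`). -/
def Dominates (lam mu : Partition) : Prop :=
  mu.size = lam.size ∧ ∀ k : ℕ, mu.psum k ≤ lam.psum k

/-- the one-row partition `(r)`. -/
def single (r : ℕ) : Partition where
  part := Finsupp.single 0 r
  antitone' := by
    intro i j hij
    by_cases hj : j = 0
    · have : i = 0 := by omega
      simp [hj, this]
    · simp only [Finsupp.single_apply]
      split <;> split <;> omega

/-- the one-column partition `(1^m)`. -/
def column (m : ℕ) : Partition where
  part := Finsupp.onFinset (Finset.range m) (fun j => if j < m then 1 else 0)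
    (fun j h => by
      simp only [Finset.mem_range]
      by_contra hc
      simp [hc] at h)
  antitone' := by
    intro i j hij
    simp only [Finsupp.onFinset_apply]
    split <;> split <;> omega

end Partition

variable {F : Type*} [Field F]

/-- the `t`-integer `[n]_t = 1 + t + ⋯ + t^{n-1}`. -/
def qint (t : F) (n : ℕ) : F := ∑ j ∈ Finset.range n, t ^ j

/-- the `t`-factorial. -/
def qfac (t : F) (n : ℕ) : F := ∏ j ∈ Finset.range n, qint t (j + 1)

/-- the Gaussian binomial coefficient `[n choose k]_t`; it vanishes
unless `0 ≤ k ≤ n`. -/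
def qbinom (t : F) (n k : ℤ) : F :=
  if 0 ≤ k ∧ k ≤ n then qfac t n.toNat / (qfac t k.toNat * qfac t (n - k).toNat) else 0

/-- the Hall--Littlewood Pieri coefficient
`ψ'_{λ/μ}(t) = ∏_{i ≥ 1} [λ'_i - λ'_{i+1} choose λ'_i - μ'_i]_t`;
it vanishes unless `μ ⊆ λ` with `λ - μ` a vertical strip. -/
def vsHL (t : F) (lam mu : Partition) : F :=
  ∏ i ∈ Finset.Icc 1 (lam.part 0 + mu.part 0),
    qbinom t ((lam.conj i : ℤ) - lam.conj (i + 1)) ((lam.conj i : ℤ) - mu.conj i)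

open Classical in
/-- the Hall--Littlewood Pieri coefficient `φ_{λ/μ}(t)`, equal to
`∏ (1 - t^{λ'_i - λ'_{i+1}})` over those `i ≥ 1` with `λ'_i = μ'_i + 1` and
`λ'_{i+1} = μ'_{i+1}`, when `μ ⊆ λ` with `λ - μ` a horizontal strip, and
vanishing otherwise. -/
def hsHL (t : F) (lam mu : Partition) : F :=
  if ∀ i : ℕ, mu.conj i ≤ lam.conj i ∧ lam.conj i ≤ mu.conj i + 1 then
    ∏ i ∈ Finset.Icc 1 (lam.part 0 + mu.part 0),
      if lam.conj i = mu.conj i + 1 ∧ lam.conj (i + 1) = mu.conj (i + 1) then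
        1 - t ^ (lam.conj i - lam.conj (i + 1))
      else 1
  else 0

/-- `n(λ/μ) = ∑_{i ≥ 1} C(λ'_i - μ'_i, 2)`. -/
def nskew (lam mu : Partition) : ℕ :=
  ∑ i ∈ Finset.Icc 1 (lam.part 0 + mu.part 0), Nat.choose (lam.conj i - mu.conj i) 2

/-- the Konvalinka--Lauve coefficient
`sk_{λ/μ}(t) = t^{n(λ/μ)} ∏_{i ≥ 1} [λ'_i - μ'_{i+1} choose λ'_i - μ'_i]_t`;
it vanishes unless `μ ⊆ λ`. -/
def skHL (t : F) (lam mu : Partition) : F :=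
  t ^ nskew lam mu *
    ∏ i ∈ Finset.Icc 1 (lam.part 0 + mu.part 0),
      qbinom t ((lam.conj i : ℤ) - mu.conj (i + 1)) ((lam.conj i : ℤ) - mu.conj i)

/-- The ring of symmetric functions over `F`, realized as the polynomial ring
in the power sums: the variable `n` is the power sum `p_{n+1}`. -/
abbrev Sym (F : Type*) [Field F] := MvPolynomial ℕ F

/-- the power sum product `p_λ = p_{λ_1} p_{λ_2} ⋯`. -/
def pprod (lam : Partition) : Sym F :=
  ∏ j ∈ lam.part.support, MvPolynomial.X (lam.part j - 1)

/-- Macdonald's `(q,t)`-deformation of the Hall inner product, for which the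
power sums are orthogonal with `⟨p_λ, p_λ⟩ = z_λ ∏_i (1-q^{λ_i})/(1-t^{λ_i})`. -/
def innerQT (q t : F) (f g : Sym F) : F :=
  ∑ d ∈ f.support,
    f.coeff d * g.coeff d *
      d.prod fun n m =>
        (((n : F) + 1) ^ m * (Nat.factorial m : F)) *
          ((1 - q ^ (n + 1)) / (1 - t ^ (n + 1))) ^ m

/-- the complete homogeneous symmetric function `h_r = ∑_{|κ| = r} z_κ⁻¹ p_κ`. -/
def hsym (F : Type*) [Field F] (r : ℕ) : Sym F :=
  ∑ᶠ (k : Partition) (_ : k.size = r), ((k.zee : F))⁻¹ • (pprod k : Sym F)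

/-- the elementary symmetric function `e_r = ∑_{|κ| = r} (-1)^{r - l(κ)} z_κ⁻¹ p_κ`. -/
def esym (F : Type*) [Field F] (r : ℕ) : Sym F :=
  ∑ᶠ (k : Partition) (_ : k.size = r),
    ((-1 : F) ^ (r - k.length) * (k.zee : F)⁻¹) • (pprod k : Sym F)

/-- `h_μ = h_{μ_1} h_{μ_2} ⋯`. -/
def hprod (F : Type*) [Field F] (mu : Partition) : Sym F :=
  ∏ j ∈ mu.part.support, hsym F (mu.part j)

/-- Characterisation of the (monic) Macdonald polynomial family
`λ ↦ P_λ(X;q,t)`: the `P_λ` are pairwise orthogonal for the `(q,t)`-inner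
product, and `P_λ = m_λ + ∑_{μ ⊲ λ} u_{λμ} m_μ` is unitriangular with respect
to dominance order in the monomial basis.  Since `{h_μ}` is the dual basis of
`{m_μ}` for the classical Hall pairing (the case `q = t`), unitriangularity is
expressed by the last two conditions.  For `q = 0` this characterises the
Hall--Littlewood polynomials `P_λ(X;t)`. -/
def IsMacdonald (q t : F) (P : Partition → Sym F) : Prop :=
  (∀ lam mu, lam ≠ mu → innerQT q t (P lam) (P mu) = 0) ∧
  (∀ lam, innerQT t t (P lam) (hprod F lam) = 1) ∧
  (∀ lam mu, ¬ Partition.Dominates lam mu → innerQT t t (P lam) (hprod F mu) = 0)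

/-- `b_λ = ⟨P_λ, P_λ⟩⁻¹`. -/
def bnorm (q t : F) (P : Partition → Sym F) (lam : Partition) : F :=
  (innerQT q t (P lam) (P lam))⁻¹

/-- `Q_λ = b_λ P_λ`. -/
def macQ (q t : F) (P : Partition → Sym F) (lam : Partition) : Sym F :=
  bnorm q t P lam • P lam

/-- the skew Macdonald polynomial `Q_{λ/μ}`, defined by
`⟨Q_{λ/μ}, P_ν⟩ = ⟨Q_λ, P_μ P_ν⟩`. -/
def skewQ (q t : F) (P : Partition → Sym F) (lam mu : Partition) : Sym F :=
  ∑ᶠ nu : Partition, innerQT q t (macQ q t P lam) (P mu * P nu) • macQ q t P nu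

/-- the skew Macdonald polynomial `P_{λ/μ}`, defined by
`⟨P_{λ/μ}, Q_ν⟩ = ⟨P_λ, Q_μ Q_ν⟩`. -/
def skewP (q t : F) (P : Partition → Sym F) (lam mu : Partition) : Sym F :=
  ∑ᶠ nu : Partition, innerQT q t (P lam) (macQ q t P mu * macQ q t P nu) • P nu

/-- the Littlewood--Richardson coefficient `f_{μν}^λ(q,t) = ⟨Q_λ, P_μ P_ν⟩`,
so that `P_μ P_ν = ∑_λ f_{μν}^λ P_λ`. -/
def lr (q t : F) (P : Partition → Sym F) (mu nu lam : Partition) : F :=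
  innerQT q t (macQ q t P lam) (P mu * P nu)

/-- the plethystic evaluation `f ↦ f((a-b)/(1-t))`, determined on power sums
by `p_r ↦ (a^r - b^r)/(1 - t^r)`. -/
def plethAB (t a b : F) (f : Sym F) : F :=
  MvPolynomial.eval (fun n => (a ^ (n + 1) - b ^ (n + 1)) / (1 - t ^ (n + 1))) f

/-- `vs_{λ/μ}(q,t) = ψ'_{λ/μ}(q,t) = (-1)^{|λ|-|μ|} Q_{λ/μ}((q-1)/(1-t))`. -/
def vsM (q t : F) (P : Partition → Sym F) (lam mu : Partition) : F :=
  (-1 : F) ^ ((lam.size : ℤ) - (mu.size : ℤ)) * plethAB t q 1 (skewQ q t P lam mu)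

/-- `sk_{λ/μ}(q,t) = Q_{λ/μ}((1-q)/(1-t))`. -/
def skM (q t : F) (P : Partition → Sym F) (lam mu : Partition) : F :=
  plethAB t 1 q (skewQ q t P lam mu)

/-- `ŝk_{λ/μ}(q,t) = Q_{λ/μ}((1-q/t)/(1-t))`. -/
def skHatM (q t : F) (P : Partition → Sym F) (lam mu : Partition) : F :=
  plethAB t 1 (q / t) (skewQ q t P lam mu)

/-- `hs_{λ/μ}(q,t) = φ_{λ/μ}(q,t) = Q_{λ/μ}(1)`, the plethystic evaluation
`p_r ↦ 1`. -/
def hsM (q t : F) (P : Partition → Sym F) (lam mu : Partition) : F :=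
  MvPolynomial.eval (fun _ => (1 : F)) (skewQ q t P lam mu)

/-- `ks_{λ/μ}(q,t) = Q_{λ/μ}(-1)`, the plethystic evaluation `p_r ↦ -1`. -/
def ksM (q t : F) (P : Partition → Sym F) (lam mu : Partition) : F :=
  MvPolynomial.eval (fun _ => (-1 : F)) (skewQ q t P lam mu)

/-- the finite `q`-Pochhammer symbol `(a;q)_k = ∏_{j=0}^{k-1}(1 - a q^j)`. -/
def qPochN (qq a : F) (k : ℕ) : F := ∏ j ∈ Finset.range k, (1 - a * qq ^ j)

/-- the `q`-Pochhammer symbol `(a;q)_k = (a;q)_∞/(a q^k;q)_∞` for `k ∈ ℤ`;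
for `k = -m < 0` it equals `1/∏_{i=1}^m (1 - a q^{-i})`. -/
def qPochZ (qq a : F) (k : ℤ) : F :=
  if 0 ≤ k then qPochN qq a k.toNat
  else (∏ j ∈ Finset.range (-k).toNat, (1 - a * (qq⁻¹) ^ (j + 1)))⁻¹

/-- `(a)_λ = (a;q,t)_λ = ∏_{i ≥ 1} (a t^{1-i}; q)_{λ_i}`. -/
def qtPoch (qq tt a : F) (lam : Partition) : F :=
  ∏ j ∈ lam.part.support, qPochN qq (a * tt ^ (-(j : ℤ))) (lam.part j)

/-- the degree (as a symmetric function) of a power-sum exponent vector. -/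
def wt (d : ℕ →₀ ℕ) : ℕ := d.sum fun n m => (n + 1) * m

/-- the degree-`r` homogeneous component of `∏_x (bx;q)_∞/(ax;q)_∞`, namely
`∑_{|κ| = r} z_κ⁻¹ ∏_i (a^{κ_i} - b^{κ_i})/(1 - q^{κ_i}) · p_κ`. -/
def prodComp (a b qq : F) (r : ℕ) : Sym F :=
  ∑ᶠ (k : Partition) (_ : k.size = r),
    ((k.zee : F)⁻¹ *
        ∏ j ∈ k.part.support,
          (a ^ k.part j - b ^ k.part j) / (1 - qq ^ k.part j)) • (pprod k : Sym F)

/-- `∏_x (bx;q)_∞/(ax;q)_∞`, where `(cx;q)_∞ = ∏_{j ≥ 0}(1 - cx q^j)`, as a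
formal power series in the power sums. -/
def prodSeries (a b qq : F) : MvPowerSeries ℕ F :=
  fun d => MvPolynomial.coeff d (prodComp a b qq (wt d))

/-- the formal (possibly infinite) sum `∑_i c_i g_i` of symmetric functions,
as a formal power series in the power sums. -/
def sumSeries {ι : Type*} (c : ι → F) (g : ι → Sym F) : MvPowerSeries ℕ F :=
  fun d => ∑ᶠ i : ι, c i * MvPolynomial.coeff d (g i)

/-- `ℚ(t)` -/
abbrev F1 : Type := RatFunc ℚ
/-- `ℚ(t)(q)` -/
abbrev F2 : Type := RatFunc F1
/-- `ℚ(t)(q)(a)` -/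
abbrev F3 : Type := RatFunc F2
/-- `ℚ(t)(q)(a)(b)` -/
abbrev F4 : Type := RatFunc F3

instance : Field F2 := inferInstance
instance : Field F3 := inferInstance
instance : Field F4 := inferInstance

/-- the indeterminate `t` in `ℚ(t)`. -/
def t1 : F1 := RatFunc.X
/-- the indeterminate `q` in `ℚ(t)(q)`. -/
def q2 : F2 := RatFunc.X
/-- the indeterminate `t` in `ℚ(t)(q)`. -/
def t2 : F2 := RatFunc.C t1
/-- the indeterminate `a` in `ℚ(t)(q)(a)`. -/
def a3 : F3 := RatFunc.X
/-- the indeterminate `q` in `ℚ(t)(q)(a)`. -/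
def q3 : F3 := RatFunc.C q2
/-- the indeterminate `t` in `ℚ(t)(q)(a)`. -/
def t3 : F3 := RatFunc.C t2
/-- the indeterminate `b` in `ℚ(t)(q)(a)(b)`. -/
def b4 : F4 := RatFunc.X
/-- the indeterminate `a` in `ℚ(t)(q)(a)(b)`. -/
def a4 : F4 := RatFunc.C a3
/-- the indeterminate `q` in `ℚ(t)(q)(a)(b)`. -/
def q4 : F4 := RatFunc.C q3
/-- the indeterminate `t` in `ℚ(t)(q)(a)(b)`. -/
def t4 : F4 := RatFunc.C t3

section Parts
variable {F : Type*} [Field F]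
set_option linter.unusedSectionVars false

/-! ### Exponential power series -/

/-- coefficients of the solution of `f' = u f`, `f(0) = 1`. -/
def exCoeff {R : Type*} [CommRing R] [Algebra ℚ R] (u : ℕ → R) : ℕ → R
  | 0 => 1
  | (k + 1) => ((1 : ℚ) / ((k : ℚ) + 1)) • ∑ i : Fin (k + 1), u i * exCoeff u (k - i)

/-- the power series `exp(∑ u_n y^{n+1}/(n+1))`. -/
def exSer {R : Type*} [CommRing R] [Algebra ℚ R] (u : ℕ → R) : PowerSeries R :=
  PowerSeries.mk (exCoeff u)

section Ex
open PowerSeries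
variable {R : Type*} [CommRing R] [Algebra ℚ R]

theorem ex_natCast_cancel (k : ℕ) {x y : R} (h : ((k : R) + 1) * x = ((k : R) + 1) * y) : x = y := by
  have h1 : ((1 : ℚ) / ((k : ℚ) + 1)) • (((k : R) + 1) * x) = ((1 : ℚ) / ((k : ℚ) + 1)) • (((k : R) + 1) * y) := by
    rw [h]
  have h2 : ∀ z : R, ((1 : ℚ) / ((k : ℚ) + 1)) • (((k : R) + 1) * z) = z := by
    intro z
    have h3 : ((k : R) + 1) * z = ((k : ℚ) + 1) • z := by
      rw [Algebra.smul_def]; simp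
    rw [h3, smul_smul, one_div, inv_mul_cancel₀ (by positivity), one_smul]
  rwa [h2, h2] at h1

theorem exCoeff_succ (u : ℕ → R) (k : ℕ) :
    ((k : R) + 1) * exCoeff u (k + 1) = ∑ i ∈ Finset.range (k + 1), u i * exCoeff u (k - i) := by
  rw [exCoeff]
  have h3 : ∀ z : R, ((k : R) + 1) * z = ((k : ℚ) + 1) • z := by
    intro z
    rw [Algebra.smul_def]; simp
  rw [h3, smul_smul, mul_one_div, div_self (by positivity), one_smul, Finset.sum_range]

theorem exSer_coeff_zero (u : ℕ → R) : coeff 0 (exSer u) = 1 := by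
  simp [exSer, exCoeff]

theorem exSer_ode (u : ℕ → R) : d⁄dX R (exSer u) = PowerSeries.mk u * exSer u := by
  ext k
  rw [coeff_derivative, coeff_mul, Finset.Nat.sum_antidiagonal_eq_sum_range_succ_mk]
  simp only [exSer, coeff_mk]
  rw [mul_comm, exCoeff_succ]

theorem exSer_unique (u : ℕ → R) (f g : PowerSeries R) (h0 : coeff 0 f = coeff 0 g)
    (hf : d⁄dX R f = PowerSeries.mk u * f) (hg : d⁄dX R g = PowerSeries.mk u * g) : f = g := by
  ext k
  induction k using Nat.strong_induction_on with
  | _ k ih =>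
    cases k with
    | zero => exact h0
    | succ k =>
      apply ex_natCast_cancel k
      have h1 := congrArg (coeff k) hf
      have h2 := congrArg (coeff k) hg
      rw [coeff_derivative, coeff_mul] at h1 h2
      rw [mul_comm, h1, mul_comm, h2]
      apply Finset.sum_congr rfl
      intro x hx
      rw [Finset.HasAntidiagonal.mem_antidiagonal] at hx
      rw [ih x.2 (by omega)]

theorem exSer_eq (u : ℕ → R) (f : PowerSeries R) (h0 : coeff 0 f = 1)
    (hf : d⁄dX R f = PowerSeries.mk u * f) : f = exSer u :=
  exSer_unique u f _ (by rw [h0, exSer_coeff_zero]) hf (exSer_ode u)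

theorem exSer_add (u v : ℕ → R) : exSer (fun n => u n + v n) = exSer u * exSer v := by
  symm
  apply exSer_eq
  · rw [coeff_mul]; simp [exSer_coeff_zero]
  · rw [Derivation.leibniz, exSer_ode, exSer_ode]
    have : (PowerSeries.mk fun n => u n + v n) = PowerSeries.mk u + PowerSeries.mk v := by
      ext; simp
    rw [this, smul_eq_mul, smul_eq_mul]; ring

theorem exSer_zero : exSer (fun _ => (0 : R)) = 1 := by
  symm
  apply exSer_eq
  · simp
  · have : (PowerSeries.mk fun _ => (0 : R)) = 0 := by ext; simp
    simp [this]

theorem exSer_map {S : Type*} [CommRing S] [Algebra ℚ S] (φ : R →+* S) (u : ℕ → R) :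
    PowerSeries.map φ (exSer u) = exSer (fun n => φ (u n)) := by
  apply exSer_eq
  · rw [coeff_map, exSer_coeff_zero, map_one]
  · ext k
    have h := congrArg φ (congrArg (coeff k) (exSer_ode u))
    rw [coeff_derivative, coeff_mul, map_mul, map_sum] at h
    rw [coeff_derivative, coeff_mul, coeff_map]
    simp only [coeff_map, coeff_mk, map_mul, map_add, map_natCast, map_one] at h ⊢
    exact h

theorem exSer_rescale (c : R) (u : ℕ → R) :
    PowerSeries.rescale c (exSer u) = exSer (fun n => c ^ (n + 1) * u n) := by
  apply exSer_eq
  · rw [coeff_rescale, exSer_coeff_zero]; simp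
  · ext k
    have h := congrArg (coeff k) (exSer_ode u)
    rw [coeff_derivative, coeff_mul] at h
    rw [coeff_derivative, coeff_mul, coeff_rescale]
    simp only [coeff_rescale, coeff_mk] at h ⊢
    rw [mul_assoc, h, Finset.mul_sum]
    apply Finset.sum_congr rfl
    intro x hx
    rw [Finset.HasAntidiagonal.mem_antidiagonal] at hx
    rw [← hx]; ring

theorem exSer_geom (a : R) : exSer (fun n => a ^ (n + 1)) * (1 - C a * X) = 1 := by
  have h : exSer (fun n => a ^ (n + 1)) = PowerSeries.mk (fun n => a ^ n) := by
    symm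
    apply exSer_eq
    · simp
    · ext k
      rw [coeff_derivative, coeff_mul, Finset.Nat.sum_antidiagonal_eq_sum_range_succ_mk]
      simp only [coeff_mk]
      rw [Finset.sum_congr rfl (g := fun _ => a ^ (k + 1))]
      · simp [mul_comm]
      · intro i hi
        rw [Finset.mem_range] at hi
        rw [← pow_add]; congr 1; omega
  rw [h]
  ext k
  rw [mul_sub, mul_one, ← mul_assoc, map_sub]
  cases k with
  | zero => simp
  | succ k => 
    rw [coeff_succ_mul_X, mul_comm, coeff_C_mul]; simp [pow_succ, mul_comm, coeff_one]

end Ex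

set_option linter.unusedSectionVars false

/-! ### Vertex operators on the ring of symmetric functions -/

section Vertex
open MvPolynomial
variable [CharZero F]

/-- `exp(∑ u_n p_{n+1} y^{n+1}/(n+1))`. -/
def genSer (u : ℕ → F) : PowerSeries (Sym F) := exSer (fun n => (C (u n) * X n : Sym F))

/-- degree `k` component of `exp(∑ u_n p_{n+1}/(n+1))`. -/
def gen (u : ℕ → F) (k : ℕ) : Sym F := PowerSeries.coeff k (genSer u)

/-- `p_{n+1} ↦ p_{n+1} + α_n z^{n+1}`. -/
def trans (α : ℕ → F) : Sym F →ₐ[F] Polynomial (Sym F) :=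
  aeval fun n => Polynomial.C (X n) + Polynomial.C (C (α n)) * Polynomial.X ^ (n + 1)

theorem trans_X (α : ℕ → F) (n : ℕ) : trans α (X n) =
    Polynomial.C (X n) + Polynomial.C (C (α n)) * Polynomial.X ^ (n + 1) := by
  simp [trans]

theorem trans_C (α : ℕ → F) (c : F) : trans α (C c) = Polynomial.C (C c) := by
  rw [trans, aeval_C]; rfl

theorem gen_zero (u : ℕ → F) : gen u 0 = 1 := exSer_coeff_zero _

theorem gen_succ (u : ℕ → F) (k : ℕ) : ((k : Sym F) + 1) * gen u (k + 1) =
    ∑ i ∈ Finset.range (k + 1), C (u i) * X i * gen u (k - i) := by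
  have := exCoeff_succ (fun n => (C (u n) * X n : Sym F)) k
  simpa [gen, genSer, exSer] using this

theorem trans_genSer (α u : ℕ → F) :
    PowerSeries.map (trans α : Sym F →+* Polynomial (Sym F)) (genSer u) =
      PowerSeries.map Polynomial.C (genSer u) *
        PowerSeries.rescale Polynomial.X
          (PowerSeries.map (Polynomial.C.comp C) (exSer (fun n => u n * α n))) := by
  rw [genSer, exSer_map, exSer_map, exSer_map, exSer_rescale, ← exSer_add]
  congr 1
  funext n
  simp only [RingHom.coe_coe, map_mul, trans_X, trans_C, RingHom.comp_apply]
  ring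

theorem trans_gen (α u : ℕ → F) (k : ℕ) : trans α (gen u k) =
    ∑ m ∈ Finset.range (k + 1), Polynomial.C (gen u (k - m)) *
      (Polynomial.C (C (PowerSeries.coeff m (exSer (fun n => u n * α n)))) * Polynomial.X ^ m) := by
  have h := congrArg (PowerSeries.coeff k) (trans_genSer α u)
  rw [PowerSeries.coeff_map, mul_comm, PowerSeries.coeff_mul,
    Finset.Nat.sum_antidiagonal_eq_sum_range_succ_mk] at h
  simp only [PowerSeries.coeff_map, PowerSeries.coeff_rescale, RingHom.comp_apply] at h
  rw [gen]
  refine Eq.trans h (Finset.sum_congr rfl fun m _ => ?_)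
  rw [gen]; ring

/-- `∑ c_j z^j ↦ ∑ g_j c_j`. -/
def pairing (g : ℕ → Sym F) : Polynomial (Sym F) →ₗ[Sym F] Sym F :=
  Polynomial.lsum fun j => LinearMap.mulLeft (Sym F) (g j)

theorem pairing_C_mul (g : ℕ → Sym F) (f : Sym F) (p : Polynomial (Sym F)) :
    pairing g (Polynomial.C f * p) = f * pairing g p := by
  rw [← Polynomial.smul_eq_C_mul, map_smul, smul_eq_mul]

theorem pairing_X_pow (g : ℕ → Sym F) (j : ℕ) : pairing g (Polynomial.X ^ j) = g j := by
  simp [pairing, Polynomial.lsum, Polynomial.X_pow_eq_monomial, Polynomial.sum_monomial_index]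

theorem pairing_X_pow_mul (g : ℕ → Sym F) (r : ℕ) (p : Polynomial (Sym F)) :
    pairing g (Polynomial.X ^ r * p) = pairing (fun j => g (j + r)) p := by
  induction p using Polynomial.induction_on' with
  | add p q hp hq => rw [mul_add, map_add, map_add, hp, hq]
  | monomial n a =>
    rw [← Polynomial.C_mul_X_pow_eq_monomial, mul_left_comm, pairing_C_mul, pairing_C_mul,
      ← pow_add, pairing_X_pow, pairing_X_pow, add_comm]

theorem pairing_one (g : ℕ → Sym F) : pairing g 1 = g 0 := by
  simpa using pairing_X_pow g 0

/-- the modes of the vertex operator. -/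
def vop (u α : ℕ → F) (k : ℕ) (f : Sym F) : Sym F :=
  pairing (fun j => gen u (k + j)) (trans α f)

theorem vop_add (u α : ℕ → F) (k : ℕ) (f g : Sym F) :
    vop u α k (f + g) = vop u α k f + vop u α k g := by
  simp [vop]

theorem vop_sub (u α : ℕ → F) (k : ℕ) (f g : Sym F) :
    vop u α k (f - g) = vop u α k f - vop u α k g := by
  simp [vop]

theorem vop_C_mul (u α : ℕ → F) (k : ℕ) (c : F) (f : Sym F) :
    vop u α k (C c * f) = C c * vop u α k f := by
  rw [vop, map_mul, trans_C, pairing_C_mul, vop]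

theorem vop_smul (u α : ℕ → F) (k : ℕ) (c : F) (f : Sym F) :
    vop u α k (c • f) = c • vop u α k f := by
  rw [smul_eq_C_mul, vop_C_mul, smul_eq_C_mul]

theorem vop_one (u α : ℕ → F) (k : ℕ) : vop u α k 1 = gen u k := by
  rw [vop, map_one, pairing_one]; rfl

theorem vop_X_mul (u α : ℕ → F) (k n : ℕ) (f : Sym F) :
    vop u α k (X n * f) = X n * vop u α k f + C (α n) * vop u α (k + (n + 1)) f := by
  rw [vop, map_mul, trans_X, add_mul, map_add, pairing_C_mul, mul_assoc, pairing_C_mul,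
    pairing_X_pow_mul, vop, vop]
  have e : (fun j => gen u (k + (j + (n + 1)))) = fun j => gen u (k + (n + 1) + j) := by
    funext j
    congr 1
    ring
  rw [e]

theorem pderiv_gen (u : ℕ → F) (n k : ℕ) :
    pderiv n (gen u k) = if n + 1 ≤ k then C (u n / ((n : F) + 1)) * gen u (k - (n + 1)) else 0 := by
  induction k using Nat.strong_induction_on with
  | _ k ih =>
    cases k with
    | zero => simp [gen_zero]
    | succ k =>
      apply ex_natCast_cancel k
      have h := congrArg (pderiv n) (gen_succ u k)
      have hk : pderiv n ((k : Sym F) + 1) = 0 := by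
        rw [map_add, ← map_natCast (C : F →+* Sym F), pderiv_C]; simp
      rw [pderiv_mul, hk, zero_mul, zero_add, map_sum] at h
      rw [h]
      have h1 : ∀ i ∈ Finset.range (k + 1), pderiv n (C (u i) * X i * gen u (k - i)) =
          (if i = n then C (u n) * gen u (k - n) else 0) +
          (if i < k - n then C (u n / ((n : F) + 1)) * (C (u i) * X i * gen u (k - n - 1 - i)) else 0) := by
        intro i hi
        rw [Finset.mem_range] at hi
        rw [pderiv_mul, pderiv_C_mul, pderiv_X, ih (k - i) (by omega)]
        congr 1
        · by_cases hin : i = n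
          · subst hin; simp
          · simp [hin]
        · by_cases hc : n + 1 ≤ k - i
          · rw [if_pos hc, if_pos (by omega)]
            rw [show k - i - (n + 1) = k - n - 1 - i by omega]; ring
          · rw [if_neg hc, if_neg (by omega)]; simp
      rw [Finset.sum_congr rfl h1, Finset.sum_add_distrib, Finset.sum_ite_eq', ← Finset.sum_filter]
      by_cases hnk : n ≤ k
      · rw [if_pos (by simpa using Nat.lt_succ_of_le hnk), if_pos (by omega)]
        have hf : (Finset.range (k + 1)).filter (fun i => i < k - n) = Finset.range (k - n) := by
          ext i; simp; omega
        rw [hf, ← Finset.mul_sum]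
        have hS : ∑ i ∈ Finset.range (k - n), C (u i) * X i * gen u (k - n - 1 - i) =
            ((k - n : ℕ) : Sym F) * gen u (k - n) := by
          obtain ⟨m, hm⟩ : ∃ m, m = k - n := ⟨_, rfl⟩
          rw [← hm]
          cases m with
          | zero => simp
          | succ m => simp only [Nat.add_sub_cancel]; rw [← gen_succ]; push_cast; ring
        rw [hS, show k + 1 - (n + 1) = k - n by omega]
        have hn : ((n : F) + 1) ≠ 0 := Nat.cast_add_one_ne_zero n
        have e1 : (C (u n) : Sym F) = C (u n / ((n : F) + 1)) * ((n : Sym F) + 1) := by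
          rw [← map_natCast (C : F →+* Sym F), ← C_1, ← C_add, ← C_mul, div_mul_cancel₀ _ hn]
        rw [e1, Nat.cast_sub hnk]; ring
      · rw [if_neg (by simp; omega), if_neg (by omega)]
        rw [Finset.filter_false_of_mem (by intro i _; omega)]; simp

end Vertex

/-! ### Inner products -/

section Inner
open MvPolynomial
variable [CharZero F]

/-- the weight of a power-sum monomial. -/
def wgt (v : ℕ → F) (d : ℕ →₀ ℕ) : F := d.prod fun n m => v n ^ m * (Nat.factorial m : F)

/-- inner product with `⟨p_{n+1}^m, p_{n+1}^m⟩ = v_n^m m!`. -/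
def inn (v : ℕ → F) (f g : Sym F) : F := ∑ d ∈ f.support, f.coeff d * g.coeff d * wgt v d

theorem innerQT_eq (q t : F) (f g : Sym F) : innerQT q t f g =
    inn (fun n => ((n : F) + 1) * ((1 - q ^ (n + 1)) / (1 - t ^ (n + 1)))) f g := by
  unfold innerQT inn wgt
  refine Finset.sum_congr rfl fun d _ => ?_
  congr 1
  apply Finsupp.prod_congr
  intro n _
  rw [mul_pow]; ring

theorem wgt_add_single (v : ℕ → F) (d : ℕ →₀ ℕ) (n : ℕ) :
    wgt v (d + Finsupp.single n 1) = v n * ((d n : F) + 1) * wgt v d := by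
  classical
  have h0 : ∀ i, v i ^ 0 * (Nat.factorial 0 : F) = 1 := by simp
  unfold wgt
  have hs : (d + Finsupp.single n 1).support ⊆ insert n d.support := by
    intro i hi
    simp only [Finsupp.mem_support_iff, Finsupp.add_apply, Finset.mem_insert] at hi ⊢
    by_contra hc
    push Not at hc
    rw [hc.2, Finsupp.single_apply, if_neg (fun h => hc.1 h.symm)] at hi
    exact hi rfl
  rw [Finsupp.prod_of_support_subset _ hs _ (fun i _ => h0 i),
    Finsupp.prod_of_support_subset d (Finset.subset_insert n d.support) _ (fun i _ => h0 i)]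
  rw [← Finset.mul_prod_erase _ _ (Finset.mem_insert_self n _),
    ← Finset.mul_prod_erase (insert n d.support) (fun i => v i ^ d i * _) (Finset.mem_insert_self n _)]
  have : ∏ x ∈ (insert n d.support).erase n, (v x ^ (d + Finsupp.single n 1 : ℕ →₀ ℕ) x * (Nat.factorial ((d + Finsupp.single n 1 : ℕ →₀ ℕ) x) : F))
     = ∏ x ∈ (insert n d.support).erase n, (v x ^ d x * (Nat.factorial (d x) : F)) := by
    refine Finset.prod_congr rfl fun x hx => ?_
    have hx := Finset.ne_of_mem_erase hx
    rw [Finsupp.add_apply, Finsupp.single_apply, if_neg (fun h => hx h.symm), add_zero]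
  rw [this]
  simp only [Finsupp.add_apply, Finsupp.single_eq_same, pow_succ, Nat.factorial_succ]
  push_cast
  ring

theorem wgt_ne_zero (v : ℕ → F) (hv : ∀ n, v n ≠ 0) (d : ℕ →₀ ℕ) : wgt v d ≠ 0 := by
  unfold wgt
  rw [Finsupp.prod]
  apply Finset.prod_ne_zero_iff.mpr
  intro n _
  exact mul_ne_zero (pow_ne_zero _ (hv n)) (Nat.cast_ne_zero.mpr (Nat.factorial_ne_zero _))

theorem inn_eq_sum (v : ℕ → F) (f g : Sym F) (S : Finset (ℕ →₀ ℕ)) (h : f.support ⊆ S) :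
    inn v f g = ∑ d ∈ S, f.coeff d * g.coeff d * wgt v d := by
  unfold inn
  apply Finset.sum_subset h
  intro d _ hd
  rw [notMem_support_iff.mp hd]; ring

theorem inn_add_left (v : ℕ → F) (f f' g : Sym F) : inn v (f + f') g = inn v f g + inn v f' g := by
  classical
  rw [inn_eq_sum v (f + f') g (f.support ∪ f'.support) support_add,
    inn_eq_sum v f g _ Finset.subset_union_left, inn_eq_sum v f' g _ Finset.subset_union_right,
    ← Finset.sum_add_distrib]
  refine Finset.sum_congr rfl fun d _ => ?_
  rw [coeff_add]; ring

theorem inn_add_right (v : ℕ → F) (f g g' : Sym F) : inn v f (g + g') = inn v f g + inn v f g' := by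
  unfold inn
  rw [← Finset.sum_add_distrib]
  refine Finset.sum_congr rfl fun d _ => ?_
  rw [coeff_add]; ring

theorem inn_smul_right (v : ℕ → F) (c : F) (f g : Sym F) : inn v f (c • g) = c * inn v f g := by
  unfold inn
  rw [Finset.mul_sum]
  refine Finset.sum_congr rfl fun d _ => ?_
  rw [coeff_smul, smul_eq_mul]; ring

theorem inn_comm (v : ℕ → F) (f g : Sym F) : inn v f g = inn v g f := by
  classical
  rw [inn_eq_sum v f g (f.support ∪ g.support) Finset.subset_union_left,
    inn_eq_sum v g f (f.support ∪ g.support) Finset.subset_union_right]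
  refine Finset.sum_congr rfl fun d _ => ?_
  ring

theorem inn_smul_left (v : ℕ → F) (c : F) (f g : Sym F) : inn v (c • f) g = c * inn v f g := by
  rw [inn_comm, inn_smul_right, inn_comm]

/-- the inner product as a bilinear map -/
def innB (v : ℕ → F) : Sym F →ₗ[F] Sym F →ₗ[F] F :=
  LinearMap.mk₂ F (inn v) (inn_add_left v) (inn_smul_left v) (inn_add_right v) (inn_smul_right v)

theorem innB_apply (v : ℕ → F) (f g : Sym F) : innB v f g = inn v f g := rfl

theorem inn_monomial_left (v : ℕ → F) (d : ℕ →₀ ℕ) (c : F) (g : Sym F) :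
    inn v (monomial d c) g = c * g.coeff d * wgt v d := by
  classical
  rw [inn_eq_sum v _ g {d} support_monomial_subset, Finset.sum_singleton, coeff_monomial, if_pos rfl]

theorem inn_X_mul (v : ℕ → F) (n : ℕ) (f g : Sym F) :
    inn v (X n * f) g = inn v f (C (v n) * pderiv n g) := by
  induction f using MvPolynomial.induction_on' with
  | monomial d c =>
    rw [X, monomial_mul, inn_monomial_left, inn_monomial_left, coeff_C_mul, coeff_pderiv, add_comm,
      wgt_add_single]
    ring
  | add p p' hp hp' => rw [mul_add, inn_add_left, hp, hp', inn_add_left]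

theorem inn_mul_X (v : ℕ → F) (n : ℕ) (f g : Sym F) :
    inn v f (X n * g) = inn v (C (v n) * pderiv n f) g := by
  rw [inn_comm, inn_X_mul, inn_comm]

theorem inn_one_right (v : ℕ → F) (f : Sym F) : inn v f 1 = f.coeff 0 := by
  rw [inn_comm, show (1 : Sym F) = monomial 0 1 from rfl, inn_monomial_left]
  simp [wgt]

theorem inn_C_mul_left (v : ℕ → F) (c : F) (f g : Sym F) : inn v (C c * f) g = c * inn v f g := by
  rw [← smul_eq_C_mul, inn_smul_left]
theorem inn_C_mul_right (v : ℕ → F) (c : F) (f g : Sym F) : inn v f (C c * g) = c * inn v f g := by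
  rw [← smul_eq_C_mul, inn_smul_right]

theorem inn_nondeg (v : ℕ → F) (hv : ∀ n, v n ≠ 0) (f : Sym F) (h : ∀ g, inn v f g = 0) : f = 0 := by
  ext d
  have h1 := h (monomial d 1)
  rw [inn_comm, inn_monomial_left, one_mul] at h1
  simpa [wgt_ne_zero v hv d] using h1

theorem gen_coeff_zero (u : ℕ → F) (k : ℕ) (hk : k ≠ 0) : (gen u k).coeff 0 = 0 := by
  obtain ⟨k, rfl⟩ := Nat.exists_eq_succ_of_ne_zero hk
  have h := congrArg (coeff 0) (gen_succ u k)
  have h2 : ((k : F) + 1) ≠ 0 := Nat.cast_add_one_ne_zero k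
  rw [show ((k : Sym F) + 1) = C ((k : F) + 1) by simp, coeff_C_mul, coeff_sum,
    Finset.sum_eq_zero] at h
  · simpa [h2] using h
  · intro i _
    rw [mul_assoc, coeff_C_mul]
    simp [coeff_X_mul']

/-- multiplication by `gen u k` is adjoint to the translation operator. -/
theorem inn_gen_mul (v u α : ℕ → F) (h : ∀ n, v n * u n = ((n : F) + 1) * α n) (k : ℕ) (f g : Sym F) :
    inn v (gen u k * f) g = inn v f ((trans α g).coeff k) := by
  induction g using MvPolynomial.induction_on generalizing k f with
  | C c =>
    rw [trans_C, Polynomial.coeff_C, show (C c : Sym F) = C c * 1 by simp, inn_C_mul_right, inn_one_right]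
    by_cases hk : k = 0
    · subst hk; rw [if_pos rfl, gen_zero, one_mul, inn_C_mul_right, inn_one_right]
    · rw [if_neg hk]
      have : (gen u k * f).coeff 0 = 0 := by
        have := (constantCoeff : Sym F →+* F).map_mul (gen u k) f
        simp only [constantCoeff_eq] at this
        rw [this, gen_coeff_zero u k hk, zero_mul]
      rw [this]; simp [inn]
  | add p p' hp hp' => rw [inn_add_right, hp, hp', map_add, Polynomial.coeff_add, inn_add_right]
  | mul_X g n ih =>
    rw [mul_comm g, inn_mul_X, pderiv_mul, map_mul, trans_X, add_mul, Polynomial.coeff_add,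
      Polynomial.coeff_C_mul, mul_assoc (Polynomial.C _), Polynomial.coeff_C_mul,
      Polynomial.coeff_X_pow_mul', mul_add, inn_add_left, inn_add_right, inn_mul_X,
      inn_C_mul_left v (v n) (gen u k * _), ih, inn_C_mul_left, inn_C_mul_left, add_comm, pderiv_gen,
      inn_C_mul_right]
    congr 1
    split_ifs with hk
    · rw [mul_assoc, inn_C_mul_left, ih, ← mul_assoc]
      congr 1
      have h2 : ((n : F) + 1) ≠ 0 := Nat.cast_add_one_ne_zero n
      rw [← mul_div_assoc, h n]; field_simp
    · simp [inn]

/-- adjoint of a vertex operator zero mode. -/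
theorem inn_vop (v u α u' α' : ℕ → F) (h : ∀ n, v n * u n = ((n : F) + 1) * α' n)
    (h' : ∀ n, v n * u' n = ((n : F) + 1) * α n) (f g : Sym F) :
    inn v (vop u α 0 f) g = inn v f (vop u' α' 0 g) := by
  have e : ∀ (u α : ℕ → F) (f : Sym F) (N : ℕ), (trans α f).natDegree < N →
      vop u α 0 f = ∑ k ∈ Finset.range N, gen u k * (trans α f).coeff k := by
    intro u α f N hN
    unfold vop pairing
    simp only [Polynomial.lsum, LinearMap.coe_mk, AddHom.coe_mk, LinearMap.mulLeft_apply, zero_add]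
    rw [Polynomial.sum_over_range' _ (by simp) N hN]
  set N := max (trans α f).natDegree (trans α' g).natDegree + 1 with hN
  rw [e u α f N (by omega), e u' α' g N (by omega)]
  rw [← innB_apply, ← innB_apply, map_sum, map_sum, LinearMap.sum_apply]
  refine Finset.sum_congr rfl fun k _ => ?_
  rw [innB_apply, innB_apply, inn_gen_mul v u α' h, inn_comm v f, inn_gen_mul v u' α h', inn_comm]

end Inner

/-! ### Combinatorics of partitions -/

section Comb

theorem Partition.ext' {l m : Partition} (h : ∀ j, l.part j = m.part j) : l = m := by
  cases l; cases m
  congr 1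
  exact Finsupp.ext h

/-- multiplicity vector: entry `n` is the number of parts equal to `n+1`. -/
def mv (l : Partition) : ℕ →₀ ℕ := ∑ j ∈ l.part.support, Finsupp.single (l.part j - 1) 1

theorem prod_mv {M : Type*} [CommMonoid M] (l : Partition) (f : ℕ → M) :
    ∏ j ∈ l.part.support, f (l.part j - 1) = (mv l).prod fun n m => f n ^ m := by
  rw [mv, ← Finsupp.prod_finsetSum_index (h := fun n m => f n ^ m) (fun _ => pow_zero _) (fun _ _ _ => pow_add _ _ _)]
  refine Finset.prod_congr rfl fun j _ => ?_
  rw [Finsupp.prod_single_index (h := fun n m => f n ^ m) (pow_zero _), pow_one]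

theorem sum_mv {M : Type*} [AddCommMonoid M] (l : Partition) (f : ℕ → M) :
    ∑ j ∈ l.part.support, f (l.part j - 1) = (mv l).sum fun n m => m • f n := by
  rw [mv, ← Finsupp.sum_finsetSum_index (h := fun n m => m • f n) (fun _ => zero_smul _ _) (fun _ _ _ => add_smul _ _ _)]
  refine Finset.sum_congr rfl fun j _ => ?_
  rw [Finsupp.sum_single_index (h := fun n m => m • f n) (zero_smul _ _), one_smul]

theorem mv_apply (l : Partition) (n : ℕ) : mv l n = l.mult (n + 1) := by
  rw [mv, Finsupp.finsetSum_apply, Partition.mult, Finset.card_filter]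
  refine Finset.sum_congr rfl fun j hj => ?_
  rw [Finsupp.mem_support_iff] at hj
  rw [Finsupp.single_apply]
  congr 1
  apply propext
  omega

theorem lower_mem_iff (S : Finset ℕ) (h : ∀ i j, i ≤ j → j ∈ S → i ∈ S) (j : ℕ) :
    j ∈ S ↔ j < S.card := by
  constructor
  · intro hj
    have : Finset.range (j + 1) ⊆ S := fun i hi => h i j (by simpa [Nat.lt_succ_iff] using hi) hj
    have := Finset.card_le_card this
    rw [Finset.card_range] at this
    omega
  · intro hj
    by_contra hc
    have : S ⊆ Finset.range j := by
      intro i hi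
      rw [Finset.mem_range]
      by_contra h2
      exact hc (h j i (by omega) hi)
    have := Finset.card_le_card this
    rw [Finset.card_range] at this
    omega

theorem lt_part_iff (l : Partition) (i j : ℕ) : i < l.part j ↔ j < l.conj (i + 1) := by
  rw [Partition.conj, ← lower_mem_iff]
  · simp only [Finset.mem_filter, Finsupp.mem_support_iff]; omega
  · intro a b hab hb
    simp only [Finset.mem_filter, Finsupp.mem_support_iff] at hb ⊢
    have := l.antitone' hab
    omega

theorem conj_eq (l : Partition) (i : ℕ) :
    l.conj (i + 1) = (mv l).sum fun n m => m • (if i ≤ n then 1 else 0) := by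
  rw [← sum_mv l (fun n => if i ≤ n then 1 else 0), Partition.conj, Finset.card_filter]
  refine Finset.sum_congr rfl fun j hj => ?_
  rw [Finsupp.mem_support_iff] at hj
  congr 1
  apply propext
  omega

theorem mv_injective : Function.Injective mv := by
  intro l m h
  apply Partition.ext'
  intro j
  have : ∀ i, i < l.part j ↔ i < m.part j := by
    intro i
    rw [lt_part_iff, lt_part_iff, conj_eq, conj_eq, h]
  have h1 := this (l.part j)
  have h2 := this (m.part j)
  omega

theorem mv_surjective : Function.Surjective mv := by
  intro d
  set L := (Finsupp.toMultiset d).sort (· ≥ ·) with hL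
  have hs : L.Pairwise (· ≥ ·) := Multiset.pairwise_sort _ _
  let f : ℕ → ℕ := fun j => if h : j < L.length then L[j] + 1 else 0
  refine ⟨⟨Finsupp.onFinset (Finset.range L.length) f ?_, ?_⟩, ?_⟩
  · intro j hj
    rw [Finset.mem_range]
    by_contra hc
    simp [f, hc] at hj
  · intro i j hij
    simp only [Finsupp.onFinset_apply, f]
    split_ifs with h1 h2
    · rcases Nat.lt_or_eq_of_le hij with h | h
      · have := List.pairwise_iff_getElem.mp hs i j h2 h1 h
        omega
      · subst h; exact le_rfl
    · omega
    · omega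
    · omega
  · have hsupp : (Finsupp.onFinset (Finset.range L.length) f (by
        intro j hj
        rw [Finset.mem_range]
        by_contra hc
        simp [f, hc] at hj)).support = Finset.range L.length := by
      ext j
      simp only [Finsupp.mem_support_iff, Finsupp.onFinset_apply, Finset.mem_range, f]
      split_ifs with h <;> simp [h]
    unfold mv
    simp only
    rw [hsupp]
    have : ∀ j ∈ Finset.range L.length, Finsupp.single (f j - 1) 1 =
        (fun j => if h : j < L.length then (Finsupp.single (L[j]) 1 : ℕ →₀ ℕ) else 0) j := by
      intro j hj
      rw [Finset.mem_range] at hj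
      simp [f, hj]
    rw [show (∑ j ∈ Finset.range L.length, Finsupp.single ((Finsupp.onFinset (Finset.range L.length) f (by
        intro j hj
        rw [Finset.mem_range]
        by_contra hc
        simp [f, hc] at hj)) j - 1) 1 : ℕ →₀ ℕ) = ∑ j ∈ Finset.range L.length, Finsupp.single (f j - 1) 1 from rfl]
    rw [Finset.sum_congr rfl this, Finset.sum_range]
    have h2 : ∀ j : Fin L.length, (fun j => if h : j < L.length then (Finsupp.single (L[j]) 1 : ℕ →₀ ℕ) else 0) (j : ℕ)
       = Finsupp.single (L[j]) 1 := by
      intro j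
      simp
    rw [Finset.sum_congr rfl (fun j _ => h2 j)]
    have h3 := Fin.sum_univ_fun_getElem L (fun n => (Finsupp.single n 1 : ℕ →₀ ℕ))
    refine Eq.trans h3 ?_
    have h4 : ∀ L : List ℕ, (L.map (fun n => (Finsupp.single n 1 : ℕ →₀ ℕ))).sum = Multiset.toFinsupp (L : Multiset ℕ) := by
      intro L
      induction L with
      | nil => simp
      | cons a L ih =>
        rw [List.map_cons, List.sum_cons, ih, ← Multiset.cons_coe, ← Multiset.singleton_add, map_add,
          Multiset.toFinsupp_singleton]
    rw [h4, hL, Multiset.sort_eq, Finsupp.toMultiset_toFinsupp]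

theorem mv_bijective : Function.Bijective mv := ⟨mv_injective, mv_surjective⟩

theorem size_eq_wt (l : Partition) : l.size = wt (mv l) := by
  rw [Partition.size, Finsupp.sum, wt]
  rw [show ((mv l).sum fun n m => (n + 1) * m) = (mv l).sum fun n m => m • (n + 1) by
    simp [mul_comm], ← sum_mv]
  refine Finset.sum_congr rfl fun j hj => ?_
  rw [Finsupp.mem_support_iff] at hj
  omega

theorem pprod_eq (l : Partition) : (pprod l : Sym F) = MvPolynomial.monomial (mv l) 1 := by
  rw [MvPolynomial.monomial_eq, MvPolynomial.C_1, one_mul, pprod, prod_mv]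

theorem zee_eq (l : Partition) : (l.zee : F) = wgt (fun n => (n : F) + 1) (mv l) := by
  rw [Partition.zee, wgt, Finsupp.prod_of_support_subset (s := Finset.range (l.part 0))]
  · have h := Finset.prod_Ico_add' (fun n : ℕ => ((n : F)) ^ (l.mult n) * (Nat.factorial (l.mult n) : F)) 0 (l.part 0) 1
    rw [Finset.range_eq_Ico]
    push_cast
    refine Eq.trans (Eq.trans ?_ h.symm) ?_
    · refine Finset.prod_congr ?_ fun _ _ => rfl
      ext; simp
    · refine Finset.prod_congr rfl fun n _ => ?_
      rw [mv_apply]; push_cast; rfl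
  · intro n hn
    rw [Finsupp.mem_support_iff, mv_apply, Partition.mult] at hn
    have := Finset.card_pos.mp (Nat.pos_of_ne_zero hn)
    obtain ⟨j, hj⟩ := this
    rw [Finset.mem_filter] at hj
    have := l.antitone' (Nat.zero_le j)
    rw [Finset.mem_range]; omega
  · intro i _; simp

theorem wt_finite (r : ℕ) : {d : ℕ →₀ ℕ | wt d = r}.Finite := by
  have : {d : ℕ →₀ ℕ | wt d = r} ⊆ Set.Iic (∑ n ∈ Finset.range r, Finsupp.single n r) := by
    intro d hd n
    have hd : wt d = r := hd
    rw [wt] at hd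
    by_cases hn : d n = 0
    · omega
    have : (n + 1) * d n ≤ r := by
      rw [← hd, Finsupp.sum]
      exact Finset.single_le_sum (f := fun n => (n + 1) * d n) (fun _ _ => Nat.zero_le _) (Finsupp.mem_support_iff.mpr hn)
    have h1 : n < r := by nlinarith [Nat.pos_of_ne_zero hn]
    rw [Finsupp.finsetSum_apply]
    rw [Finset.sum_eq_single n]
    · simp; nlinarith
    · intro b _ hb; simp [hb]
    · intro h; exact absurd (Finset.mem_range.mpr h1) h
  exact (Set.finite_Iic _).subset this

theorem size_finite (r : ℕ) : {l : Partition | l.size = r}.Finite := by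
  have := (wt_finite r).preimage (f := mv) mv_injective.injOn
  refine this.subset fun l hl => ?_
  have hl : l.size = r := hl
  simpa [size_eq_wt] using hl

end Comb

/-! ### Complete homogeneous functions -/

section Hsym
open MvPolynomial
variable [CharZero F]

/-- `p_r ↦ α z^r`. -/
def zev (α : ℕ → F) : Sym F →ₐ[F] Polynomial F :=
  aeval fun n => Polynomial.C (α n) * Polynomial.X ^ (n + 1)

theorem zev_monomial (α : ℕ → F) (d : ℕ →₀ ℕ) (c : F) : zev α (monomial d c) =
    Polynomial.C (c * d.prod fun n m => α n ^ m) * Polynomial.X ^ wt d := by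
  rw [zev, aeval_monomial, wt, Finsupp.prod, Finsupp.prod, Finsupp.sum]
  simp only [mul_pow, Finset.prod_mul_distrib, ← pow_mul, Finset.prod_pow_eq_pow_sum, map_mul, map_prod, map_pow]
  rw [mul_assoc]; rfl

theorem map_trans (α : ℕ → F) (g : Sym F) :
    Polynomial.map (constantCoeff : Sym F →+* F) (trans α g) = zev α g := by
  induction g using MvPolynomial.induction_on with
  | C c => rw [trans_C, zev, aeval_C, Polynomial.map_C, constantCoeff_C]; rfl
  | add p q hp hq => rw [map_add, Polynomial.map_add, hp, hq, map_add]
  | mul_X p n hp => 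
    rw [map_mul, Polynomial.map_mul, hp, map_mul, trans_X]
    simp [zev]

theorem inn_gen (v u α : ℕ → F) (h : ∀ n, v n * u n = ((n : F) + 1) * α n) (k : ℕ) (g : Sym F) :
    inn v (gen u k) g = (zev α g).coeff k := by
  rw [← mul_one (gen u k), inn_gen_mul v u α h, inn_comm, inn_one_right, ← map_trans, Polynomial.coeff_map]
  rfl

/-- the complete homogeneous function -/
def hh (F : Type*) [Field F] [CharZero F] (k : ℕ) : Sym F := gen (fun _ => (1 : F)) k

theorem hh_coeff (k : ℕ) (d : ℕ →₀ ℕ) : (hh F k).coeff d =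
    if wt d = k then (wgt (fun n => (n : F) + 1) d)⁻¹ else 0 := by
  have h := inn_gen (fun n => (n : F) + 1) (fun _ => 1) (fun _ => 1) (fun _ => rfl) k (monomial d 1)
  rw [inn_comm, inn_monomial_left, zev_monomial, Polynomial.coeff_C_mul, Polynomial.coeff_X_pow] at h
  have hw : wgt (fun n => (n : F) + 1) d ≠ 0 := wgt_ne_zero _ (fun n => Nat.cast_add_one_ne_zero n) d
  have h2 : (hh F k).coeff d * wgt (fun n => (n : F) + 1) d = if wt d = k then 1 else 0 := by
    have e : (k = wt d) = (wt d = k) := propext eq_comm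
    simpa [e, hh] using h
  rw [eq_comm, ← mul_left_inj' hw, h2]
  split_ifs
  · rw [inv_mul_cancel₀ hw]
  · rw [zero_mul]

theorem hsym_eq (r : ℕ) : hsym F r = hh F r := by
  rw [hsym]
  have h1 : (∑ᶠ (k : Partition) (_ : k.size = r), ((k.zee : F))⁻¹ • (pprod k : Sym F)) =
      ∑ᶠ (d : ℕ →₀ ℕ) (_ : wt d = r), (wgt (fun n => (n : F) + 1) d)⁻¹ • (monomial d (1 : F)) := by
    apply finsum_eq_of_bijective mv mv_bijective
    intro k
    rw [size_eq_wt, zee_eq, pprod_eq]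
  refine (h1.trans (finsum_mem_eq_finite_toFinset_sum (s := {d : ℕ →₀ ℕ | wt d = r}) _ (wt_finite r))).trans ?_
  ext d
  rw [coeff_sum, hh_coeff]
  simp only [coeff_smul, coeff_monomial, smul_eq_mul, mul_ite, mul_one, mul_zero]
  rw [Finset.sum_ite_eq']
  simp

theorem hh_zero : hh F 0 = 1 := gen_zero _

/-- products of complete homogeneous functions -/
def hmon (d : ℕ →₀ ℕ) : Sym F := d.prod fun n m => hh F (n + 1) ^ m

theorem hmon_add (d e : ℕ →₀ ℕ) : (hmon (d + e) : Sym F) = hmon d * hmon e := by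
  rw [hmon, Finsupp.prod_add_index' (fun _ => pow_zero _) (fun _ _ _ => pow_add _ _ _)]; rfl

theorem hmon_single (n : ℕ) : (hmon (Finsupp.single n 1) : Sym F) = hh F (n + 1) := by
  rw [hmon, Finsupp.prod_single_index (h := fun n m => hh F (n + 1) ^ m) (pow_zero _), pow_one]

theorem hprod_eq (l : Partition) : hprod F l = hmon (mv l) := by
  rw [hmon, ← prod_mv l (fun n => hh F (n + 1)), hprod]
  refine Finset.prod_congr rfl fun j hj => ?_
  rw [Finsupp.mem_support_iff] at hj
  rw [hsym_eq, Nat.sub_add_cancel (by omega)]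

theorem hmon_span : Submodule.span F (Set.range (hmon (F := F))) = ⊤ := by
  set φ : Sym F →ₐ[F] Sym F := aeval fun n => hh F (n + 1) with hφ
  have h1 : ∀ n, (X n : Sym F) ∈ φ.range := by
    intro n
    induction n using Nat.strong_induction_on with
    | _ n ih =>
      have h := gen_succ (fun _ => (1 : F)) n
      rw [Finset.sum_range_succ] at h
      simp only [C_1, one_mul, Nat.sub_self, gen_zero, mul_one] at h
      have : (X n : Sym F) = ((n : Sym F) + 1) * hh F (n + 1) - ∑ i ∈ Finset.range n, X i * hh F (n - i) := by
        rw [hh, h]; simp [hh]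
      rw [this]
      have hg : ∀ k, hh F (k + 1) ∈ φ.range := fun k => ⟨X k, by simp [hφ]⟩
      apply sub_mem
      · exact mul_mem (add_mem (natCast_mem _ n) (one_mem _)) (hg n)
      · apply sum_mem
        intro i hi
        rw [Finset.mem_range] at hi
        refine mul_mem (ih i hi) ?_
        have := hg (n - i - 1)
        rwa [Nat.sub_add_cancel (by omega)] at this
  have h2 : φ.range = ⊤ := by
    rw [eq_top_iff, ← adjoin_range_X]
    apply Algebra.adjoin_le
    rintro _ ⟨n, rfl⟩
    exact h1 n
  rw [eq_top_iff]
  intro f _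
  have : f ∈ φ.range := by rw [h2]; trivial
  obtain ⟨p, rfl⟩ := this
  induction p using MvPolynomial.induction_on' with
  | monomial d a =>
    have : φ (monomial d a) = a • hmon d := by
      rw [hφ, aeval_monomial, Algebra.smul_def]; rfl
    change φ (monomial d a) ∈ _
    rw [this]
    exact Submodule.smul_mem _ _ (Submodule.subset_span ⟨d, rfl⟩)
  | add p q hp hq => 
    change φ (p + q) ∈ _
    rw [map_add]; exact add_mem (hp trivial) (hq trivial)

/-- the part of the symmetric functions strictly above `d` -/
def Wup (d : ℕ →₀ ℕ) : Submodule F (Sym F) :=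
  Submodule.span F (Set.image hmon {k | toColex d < toColex k})

theorem Wup_mul (d e : ℕ →₀ ℕ) (f : Sym F) (hf : f ∈ Wup d) : hmon e * f ∈ Wup (d + e) := by
  rw [Wup] at hf
  induction hf using Submodule.span_induction with
  | mem x hx =>
    obtain ⟨k, hk, rfl⟩ := hx
    rw [← hmon_add]
    refine Submodule.subset_span ⟨_, ?_, rfl⟩
    have hk : toColex d < toColex k := hk
    change toColex (d + e) < toColex (e + k)
    rw [add_comm d e]
    exact add_lt_add_right hk (toColex e)
  | zero => rw [mul_zero]; exact zero_mem _
  | add x y _ _ hx hy => rw [mul_add]; exact add_mem hx hy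
  | smul a x _ hx => rw [mul_smul_comm]; exact Submodule.smul_mem _ _ hx

theorem Wup_ideal (d : ℕ →₀ ℕ) (N n : ℕ) (hd : ∀ m, N ≤ m → d m = 0) (hn : N ≤ n) (f : Sym F) :
    f * hh F (n + 1) ∈ Wup d := by
  have hf : f ∈ Submodule.span F (Set.range (hmon (F := F))) := by rw [hmon_span]; trivial
  induction hf using Submodule.span_induction with
  | mem x hx =>
    obtain ⟨k, rfl⟩ := hx
    rw [← hmon_single, ← hmon_add]
    refine Submodule.subset_span ⟨_, ?_, rfl⟩
    have h1 : toColex d < toColex (Finsupp.single n 1) := by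
      rw [Finsupp.Colex.lt_iff]
      refine ⟨n, fun j hj => ?_, ?_⟩
      · change d j = (Finsupp.single n 1 : ℕ →₀ ℕ) j
        rw [hd j (by omega), Finsupp.single_apply, if_neg (by omega)]
      · change d n < (Finsupp.single n 1 : ℕ →₀ ℕ) n
        rw [hd n hn]; simp
    refine lt_of_lt_of_le h1 ?_
    exact Finsupp.toColex_monotone (by simp)
  | zero => rw [zero_mul]; exact zero_mem _
  | add x y _ _ hx hy => rw [add_mul]; exact add_mem hx hy
  | smul a x _ hx => rw [smul_mul_assoc]; exact Submodule.smul_mem _ _ hx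

end Hsym

/-! ### Triangularity -/

section Tri
open MvPolynomial

/-- remove the first row -/
def ptail (l : Partition) : Partition where
  part := l.part.comapDomain Nat.succ (Nat.succ_injective.injOn)
  antitone' := by
    intro i j hij
    simp only [Finsupp.comapDomain_apply]
    exact l.antitone' (Nat.succ_le_succ hij)

theorem ptail_part (l : Partition) (j : ℕ) : (ptail l).part j = l.part (j + 1) := rfl

theorem exists_part_zero (l : Partition) : ∃ K, ∀ j, K ≤ j → l.part j = 0 := by
  refine ⟨l.conj 1, fun j hj => ?_⟩
  by_contra hc
  have := (lt_part_iff l 0 j).mp (by omega)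
  rw [zero_add] at this
  omega

theorem sum_supp {M : Type*} [AddCommMonoid M] (l : Partition) (f : ℕ → ℕ → M) (K : ℕ)
    (hK : ∀ j, K ≤ j → l.part j = 0) (hf : ∀ j, f j 0 = 0) :
    ∑ j ∈ l.part.support, f j (l.part j) = ∑ j ∈ Finset.range K, f j (l.part j) := by
  apply Finset.sum_subset
  · intro j hj
    rw [Finsupp.mem_support_iff] at hj
    rw [Finset.mem_range]
    by_contra hc
    exact hj (hK j (by omega))
  · intro j _ hj
    rw [Finsupp.notMem_support_iff] at hj
    rw [hj, hf]

theorem sum_tail {M : Type*} [AddCommMonoid M] (l : Partition) (f : ℕ → ℕ → M) (hf : ∀ j, f j 0 = 0) :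
    ∑ j ∈ l.part.support, f j (l.part j) =
      (∑ j ∈ (ptail l).part.support, f (j + 1) ((ptail l).part j)) + f 0 (l.part 0) := by
  obtain ⟨K, hK⟩ := exists_part_zero l
  rw [sum_supp l f (K + 1) (fun j hj => hK j (by omega)) hf, Finset.sum_range_succ',
    sum_supp (ptail l) (fun j => f (j + 1)) K (fun j hj => hK (j + 1) (by omega)) (fun j => hf _)]
  rfl

theorem mv_tail (l : Partition) (h : l.part 0 ≠ 0) :
    mv l = mv (ptail l) + Finsupp.single (l.part 0 - 1) 1 := by
  have key : ∀ l : Partition, mv l = ∑ j ∈ l.part.support, if l.part j = 0 then 0 else Finsupp.single (l.part j - 1) 1 := by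
    intro l
    refine Finset.sum_congr rfl fun j hj => ?_
    rw [Finsupp.mem_support_iff] at hj
    rw [if_neg hj]
  rw [key, key, sum_tail l (fun _ k => if k = 0 then 0 else Finsupp.single (k - 1) 1) (fun _ => if_pos rfl), if_neg h]

theorem size_tail (l : Partition) : l.size = (ptail l).size + l.part 0 :=
  sum_tail l (fun _ k => k) (fun _ => rfl)

theorem eq_zero_part (l : Partition) (h : l.part 0 = 0) : l.part = 0 := by
  ext j
  have := l.antitone' (Nat.zero_le j)
  simp; omega

/-- eigenvalue -/
def ev (p s : F) (l : Partition) : F := 1 + (1 - s) * ∑ j ∈ l.part.support, s ^ j * (p ^ l.part j - 1)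

theorem ev_tail (p s : F) (l : Partition) : ev p s l = (1 - s) * p ^ l.part 0 + s * ev p s (ptail l) := by
  rw [ev, sum_tail l (fun j k => s ^ j * (p ^ k - 1)) (by simp), ev]
  simp only [pow_succ]
  have : ∑ j ∈ (ptail l).part.support, s ^ j * s * (p ^ (ptail l).part j - 1) =
    s * ∑ j ∈ (ptail l).part.support, s ^ j * (p ^ (ptail l).part j - 1) := by
    rw [Finset.mul_sum]
    exact Finset.sum_congr rfl fun j _ => by ring
  rw [this]
  ring

variable [CharZero F]

theorem exSer_one_sub (s : F) : exSer (fun n => 1 - s ^ (n + 1)) * (1 - PowerSeries.X) = 1 - PowerSeries.C s * PowerSeries.X := by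
  have h1 := exSer_geom (1 : F)
  have h2 := exSer_geom s
  have h3 := exSer_add (fun n => (1 : F) - s ^ (n + 1)) (fun n => s ^ (n + 1))
  simp only [sub_add_cancel] at h3
  simp only [one_pow, map_one, one_mul] at h1
  rw [h3, mul_assoc] at h1
  calc _ = exSer (fun n => 1 - s ^ (n + 1)) * (1 - PowerSeries.X) * (exSer (fun n => s ^ (n + 1)) * (1 - PowerSeries.C s * PowerSeries.X)) := by rw [h2, mul_one]
    _ = (exSer (fun n => 1 - s ^ (n + 1)) * (exSer (fun n => s ^ (n + 1)) * (1 - PowerSeries.X))) * (1 - PowerSeries.C s * PowerSeries.X) := by ring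
    _ = _ := by rw [h1, one_mul]

theorem coeff_of_mul_one_sub (A : PowerSeries F) (b s : F)
    (h : A * (1 - PowerSeries.C b * PowerSeries.X) = 1 - PowerSeries.C s * PowerSeries.X) (m : ℕ) :
    PowerSeries.coeff (m + 1) A = (b - s) * b ^ m := by
  have h' : ∀ k, PowerSeries.coeff (k + 1) A - b * PowerSeries.coeff k A = if k = 0 then - s else 0 := by
    intro k
    have := congrArg (PowerSeries.coeff (k + 1)) h
    rw [mul_sub, mul_one, mul_left_comm, map_sub, PowerSeries.coeff_C_mul, PowerSeries.coeff_succ_mul_X,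
      map_sub, PowerSeries.coeff_C_mul, PowerSeries.coeff_X, PowerSeries.coeff_one] at this
    rw [this]
    cases k <;> simp
  have h0 : PowerSeries.coeff 0 A = 1 := by
    have := congrArg (PowerSeries.coeff 0) h
    simpa using this
  induction m with
  | zero =>
    have := h' 0
    rw [h0, if_pos rfl] at this
    simp only [zero_add] at this ⊢
    linear_combination this
  | succ m ih =>
    have := h' (m + 1)
    rw [ih, if_neg (by omega)] at this
    rw [pow_succ]
    linear_combination this

theorem trans_hh (s : F) (N : ℕ) : trans (fun n => 1 - s ^ (n + 1)) (hh F N) =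
    Polynomial.C (C s * hh F N) + ∑ m ∈ Finset.range (N + 1), Polynomial.C (C (1 - s) * hh F (N - m)) * Polynomial.X ^ m := by
  rw [hh, trans_gen, Finset.sum_range_succ', Finset.sum_range_succ']
  have hc : ∀ m, PowerSeries.coeff (m + 1) (exSer (fun n => (1 : F) * (1 - s ^ (n + 1)))) = 1 - s := by
    intro m
    simp only [one_mul]
    have := coeff_of_mul_one_sub _ 1 s (by simpa using exSer_one_sub s) m
    simpa using this
  have h0 : PowerSeries.coeff 0 (exSer (fun n => (1 : F) * (1 - s ^ (n + 1)))) = 1 := exSer_coeff_zero _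
  rw [h0]
  have : ∑ k ∈ Finset.range N, Polynomial.C (gen (fun _ => (1 : F)) (N - (k + 1))) *
      (Polynomial.C (C (PowerSeries.coeff (k + 1) (exSer (fun n => (1 : F) * (1 - s ^ (n + 1)))))) * Polynomial.X ^ (k + 1)) =
      ∑ k ∈ Finset.range N, Polynomial.C (C (1 - s) * hh F (N - (k + 1))) * Polynomial.X ^ (k + 1) := by
    refine Finset.sum_congr rfl fun k _ => ?_
    rw [hc, hh, map_mul]; ring
  rw [this]
  simp only [hh, Nat.sub_zero, pow_zero, mul_one, map_mul, map_sub, map_one]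
  ring

theorem pairing_eq_sum (g : ℕ → Sym F) (p : Polynomial (Sym F)) (N : ℕ) (hN : p.natDegree < N) :
    pairing g p = ∑ k ∈ Finset.range N, g k * p.coeff k := by
  unfold pairing
  simp only [Polynomial.lsum, LinearMap.coe_mk, AddHom.coe_mk, LinearMap.mulLeft_apply]
  rw [Polynomial.sum_over_range' _ (by simp) N hN]

theorem hh_phi (p : F) (M : ℕ) : ∑ m ∈ Finset.range (M + 1), gen (fun n => p ^ (n + 1) - 1) m * hh F (M - m) = C (p ^ M) * hh F M := by
  have h1 : genSer (fun n => p ^ (n + 1) - 1) * genSer (fun _ => (1 : F)) = PowerSeries.rescale (C p) (genSer (fun _ => (1 : F))) := by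
    rw [genSer, genSer, exSer_rescale, ← exSer_add]
    congr 1
    funext n
    simp only [map_sub, map_one, map_pow]; ring
  have h2 := congrArg (PowerSeries.coeff M) h1
  rw [PowerSeries.coeff_mul, Finset.Nat.sum_antidiagonal_eq_sum_range_succ_mk, PowerSeries.coeff_rescale] at h2
  rw [map_pow]
  exact h2

theorem trans_coeff_zero (α : ℕ → F) (f : Sym F) : (trans α f).coeff 0 = f := by
  induction f using MvPolynomial.induction_on with
  | C c => rw [trans_C, Polynomial.coeff_C_zero]
  | add p q hp hq => rw [map_add, Polynomial.coeff_add, hp, hq]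
  | mul_X p n hp => 
    rw [map_mul, Polynomial.mul_coeff_zero, hp, trans_X]
    simp

theorem peel (p s : F) (d : ℕ →₀ ℕ) (N : ℕ) (hd : ∀ m, N ≤ m → d m = 0) (f : Sym F) :
    vop (fun n => p ^ (n + 1) - 1) (fun n => 1 - s ^ (n + 1)) 0 (hh F N * f)
      - C ((1 - s) * p ^ N) * (hh F N * f)
      - C s * (hh F N * vop (fun n => p ^ (n + 1) - 1) (fun n => 1 - s ^ (n + 1)) 0 f) ∈ Wup d := by
  set u : ℕ → F := fun n => p ^ (n + 1) - 1
  set α : ℕ → F := fun n => 1 - s ^ (n + 1) with hα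
  obtain ⟨D, hD⟩ : ∃ D, D = (trans α f).natDegree := ⟨_, rfl⟩
  have h1 : vop u α 0 (hh F N * f) = C s * (hh F N * vop u α 0 f) + 
      C (1 - s) * ∑ m ∈ Finset.range (N + 1), hh F (N - m) * vop u α m f := by
    rw [vop, map_mul, hα, trans_hh, add_mul, map_add, pairing_C_mul, Finset.sum_mul, map_sum, Finset.mul_sum, ← hα]
    congr 1
    · rw [vop]; ring
    · refine Finset.sum_congr rfl fun m _ => ?_
      rw [mul_assoc, pairing_C_mul, pairing_X_pow_mul, mul_assoc, vop]
      congr 3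
      have : (fun j => gen u (0 + (j + m))) = fun j => gen u (m + j) := by
        funext j; congr 1; omega
      rw [this]
  have h2 : ∑ m ∈ Finset.range (N + 1), hh F (N - m) * vop u α m f =
     C (p ^ N) * hh F N * f + ∑ j ∈ Finset.range D, (∑ m ∈ Finset.range (N + 1), hh F (N - m) * gen u (m + (j + 1))) * (trans α f).coeff (j + 1) := by
    have : ∀ m, vop u α m f = ∑ j ∈ Finset.range (D + 1), gen u (m + j) * (trans α f).coeff j := by
      intro m
      rw [vop, pairing_eq_sum _ _ (D + 1) (by omega)]
    simp only [this]
    simp only [Finset.mul_sum]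
    rw [Finset.sum_comm, Finset.sum_range_succ', add_comm]
    congr 1
    · rw [trans_coeff_zero, ← hh_phi, Finset.sum_mul]
      refine Finset.sum_congr rfl fun m _ => ?_
      rw [add_zero]; ring
    · refine Finset.sum_congr rfl fun j _ => ?_
      rw [Finset.sum_mul]
      exact Finset.sum_congr rfl fun m _ => by ring
  rw [h1, h2]
  have h3 : ∀ j, ∑ m ∈ Finset.range (N + 1), hh F (N - m) * gen u (m + (j + 1)) =
      C (p ^ (N + (j + 1))) * hh F (N + j + 1) - ∑ i ∈ Finset.range (j + 1), gen u i * hh F (N + (j - i) + 1) := by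
    intro j
    rw [eq_sub_iff_add_eq, add_comm N (j + 1), show N + j + 1 = j + 1 + N by omega, ← hh_phi, show j + 1 + N + 1 = (j + 1) + (N + 1) by omega, Finset.sum_range_add _ (j + 1) (N + 1), add_comm]
    congr 1
    · refine Finset.sum_congr rfl fun i hi => ?_
      rw [Finset.mem_range] at hi
      rw [show N + (j - i) + 1 = j + 1 + N - i by omega]
    · refine Finset.sum_congr rfl fun i hi => ?_
      rw [Finset.mem_range] at hi
      rw [show N - i = j + 1 + N - (j + 1 + i) by omega, add_comm i]; ring
  have h4 : ∑ j ∈ Finset.range D, (∑ m ∈ Finset.range (N + 1), hh F (N - m) * gen u (m + (j + 1))) * (trans α f).coeff (j + 1) ∈ Wup d := by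
    apply sum_mem
    intro j _
    rw [h3, sub_mul, Finset.sum_mul]
    apply sub_mem
    · rw [mul_right_comm]
      exact Wup_ideal d N (N + j) hd (by omega) _
    · apply sum_mem
      intro i _
      rw [mul_right_comm]
      exact Wup_ideal d N (N + (j - i)) hd (by omega) _
  have h5 := Submodule.smul_mem (Wup d) (1 - s) h4
  convert h5 using 1
  rw [smul_eq_C_mul, map_mul]
  ring

theorem tri (p s : F) (l : Partition) :
    vop (fun n => p ^ (n + 1) - 1) (fun n => 1 - s ^ (n + 1)) 0 (hmon (mv l)) - C (ev p s l) * hmon (mv l) ∈ Wup (mv l) := by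
  obtain ⟨n, hn⟩ : ∃ n, l.size = n := ⟨_, rfl⟩
  induction n using Nat.strong_induction_on generalizing l with
  | _ n ih =>
  by_cases h0 : l.part 0 = 0
  · have := eq_zero_part l h0
    have h1 : mv l = 0 := by simp [mv, this]
    have h2 : ev p s l = 1 := by simp [ev, this]
    rw [h1, h2, show (hmon 0 : Sym F) = 1 by simp [hmon], vop_one, gen_zero]
    simp
  · have hs := size_tail l
    have ih := ih _ (by omega) (ptail l) rfl
    have e1 : (hmon (mv l) : Sym F) = hh F (l.part 0) * hmon (mv (ptail l)) := by
      rw [mv_tail l h0, hmon_add, hmon_single, Nat.sub_add_cancel (by omega), mul_comm]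
    have hd : ∀ m, l.part 0 ≤ m → mv l m = 0 := by
      intro m hm
      rw [mv_apply, Partition.mult, Finset.card_eq_zero, Finset.filter_eq_empty_iff]
      intro j _ hj
      have := l.antitone' (Nat.zero_le j)
      omega
    have h1 := peel p s (mv l) (l.part 0) hd (hmon (mv (ptail l)))
    have h2 := Wup_mul (mv (ptail l)) (Finsupp.single (l.part 0 - 1) 1) _ ih
    rw [← mv_tail l h0, hmon_single, Nat.sub_add_cancel (by omega)] at h2
    have h3 := add_mem h1 (Submodule.smul_mem _ s h2)
    convert h3 using 1
    rw [e1, smul_eq_C_mul, ev_tail, map_add, map_mul, map_mul C s]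
    ring

end Tri

/-! ### Homogeneity and the Macdonald basis -/

section Mac
open MvPolynomial

instance : DecidableEq Partition := Classical.decEq _

theorem wt_eq_weight (d : ℕ →₀ ℕ) : Finsupp.weight (fun n : ℕ => n + 1) d = wt d := by
  rw [Finsupp.weight_apply, wt]
  simp [mul_comm]

/-- homogeneous of degree `k` -/
abbrev IsH (f : Sym F) (k : ℕ) : Prop := IsWeightedHomogeneous (fun n : ℕ => n + 1) f k

theorem dominates_colex (l m : Partition) (h : l.Dominates m) : toColex (mv m) ≤ toColex (mv l) := by
  by_contra hc
  rw [not_le, Finsupp.Colex.lt_iff] at hc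
  obtain ⟨n, h1, h2⟩ := hc
  have h1 : ∀ j, n < j → mv l j = mv m j := h1
  replace h2 : mv l n < mv m n := h2
  have e : ∀ i, n < i → l.conj (i + 1) = m.conj (i + 1) := by
    intro i hi
    rw [conj_eq, conj_eq]
    have : ∀ d : ℕ →₀ ℕ, ∀ K, d.support ⊆ Finset.range K → (d.sum fun n m => m • (if i ≤ n then 1 else 0)) =
        ∑ j ∈ Finset.range K, d j • (if i ≤ j then 1 else 0) := by
      intro d K hK
      exact Finsupp.sum_of_support_subset _ hK _ (by simp)
    obtain ⟨K, hK⟩ : ∃ K, (mv l).support ∪ (mv m).support ⊆ Finset.range K := Finset.exists_nat_subset_range _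
    rw [this _ K (Finset.union_subset_left hK), this _ K (Finset.union_subset_right hK)]
    refine Finset.sum_congr rfl fun j _ => ?_
    split_ifs with hj
    · rw [h1 j (by omega)]
    · simp
  have e2 : ∀ l : Partition, l.conj (n + 1) = l.conj (n + 2) + mv l n := by
    intro l
    rw [mv_apply, Partition.conj, Partition.conj, Partition.mult, ← Finset.card_union_of_disjoint]
    · congr 1
      ext j
      simp only [Finset.mem_filter, Finset.mem_union]
      by_cases hj : j ∈ l.part.support
      · simp only [hj, true_and]; omega
      · simp [hj]
    · rw [Finset.disjoint_left]
      intro j hj hj'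
      simp only [Finset.mem_filter] at hj hj'
      omega
  have e3 : l.conj (n + 2) = m.conj (n + 2) := e (n + 1) (by omega)
  have e4 := e2 l
  have e5 := e2 m
  have hk := h.2 (m.conj (n + 1))
  have hlt : l.psum (m.conj (n + 1)) < m.psum (m.conj (n + 1)) := by
    rw [Partition.psum, Partition.psum]
    have key : ∀ j, j < m.conj (n + 1) → (l.part j ≤ m.part j ∧ (l.conj (n + 1) ≤ j → l.part j < m.part j)) := by
      intro j hj
      have hj' := (lt_part_iff m n j).mpr hj
      constructor
      · by_contra hc
        have : l.part j > n + 1 := by omega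
        obtain ⟨i, hi⟩ : ∃ i, l.part j = i + 1 := ⟨l.part j - 1, by omega⟩
        have a1 := (lt_part_iff l i j).mp (by omega)
        rw [e i (by omega)] at a1
        have := (lt_part_iff m i j).mpr a1
        omega
      · intro hl
        have : ¬ n < l.part j := by rw [lt_part_iff]; omega
        omega
    apply Finset.sum_lt_sum
    · intro j hj
      exact (key j (Finset.mem_range.mp hj)).1
    · refine ⟨l.conj (n + 1), Finset.mem_range.mpr (by omega), (key _ (by omega)).2 le_rfl⟩
  omega

theorem dominates_size (l m : Partition) (h : l.Dominates m) : m.size = l.size := h.1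

variable [CharZero F]

theorem gen_isH (u : ℕ → F) (k : ℕ) : IsH (gen u k) k := by
  intro d hd
  have h := inn_gen (fun n => (n : F) + 1) u u (fun _ => rfl) k (monomial d 1)
  rw [inn_comm, inn_monomial_left, zev_monomial, Polynomial.coeff_C_mul, Polynomial.coeff_X_pow] at h
  have hw : wgt (fun n => (n : F) + 1) d ≠ 0 := wgt_ne_zero _ (fun n => Nat.cast_add_one_ne_zero n) d
  rw [wt_eq_weight]
  by_contra hc
  rw [if_neg (fun h => hc h.symm), mul_zero, one_mul] at h
  exact (mul_ne_zero hd hw) h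

theorem hmon_isH (l : Partition) : IsH (hmon (mv l) : Sym F) l.size := by
  rw [← hprod_eq, hprod, Partition.size, Finsupp.sum]
  apply IsWeightedHomogeneous.prod
  intro j _
  rw [hsym_eq]
  exact gen_isH _ _

theorem inn_isH (v : ℕ → F) (f g : Sym F) (m n : ℕ) (hf : IsH f m) (hg : IsH g n) (h : m ≠ n) : inn v f g = 0 := by
  unfold inn
  refine Finset.sum_eq_zero fun d _ => ?_
  by_cases h1 : f.coeff d = 0
  · rw [h1]; ring
  by_cases h2 : g.coeff d = 0
  · rw [h2]; ring
  exact absurd ((hf h1).symm.trans (hg h2)) h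

/-- homogeneous component -/
abbrev hcomp (k : ℕ) (f : Sym F) : Sym F := weightedHomogeneousComponent (fun n : ℕ => n + 1) k f

theorem inn_hcomp (v : ℕ → F) (f g : Sym F) (k : ℕ) (hg : IsH g k) : inn v (hcomp k f) g = inn v f g := by
  rw [inn_comm, inn_comm v f]
  unfold inn
  refine Finset.sum_congr rfl fun d hd => ?_
  rw [mem_support_iff] at hd
  rw [coeff_weightedHomogeneousComponent, if_pos (hg hd)]

/-- norms of power sums in the (q,t) case -/
def vqt (q t : F) (n : ℕ) : F := ((n : F) + 1) * ((1 - q ^ (n + 1)) / (1 - t ^ (n + 1)))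

/-- the Hall case -/
def vH (n : ℕ) : F := (n : F) + 1

theorem vH_ne (n : ℕ) : (vH n : F) ≠ 0 := Nat.cast_add_one_ne_zero n

/-- Macdonald family with generic parameters. -/
structure Mac (q t : F) (P : Partition → Sym F) : Prop where
  q0 : q ≠ 0
  t0 : t ≠ 0
  hq : ∀ n : ℕ, 1 - q ^ (n + 1) ≠ 0
  ht : ∀ n : ℕ, 1 - t ^ (n + 1) ≠ 0
  mac : IsMacdonald q t P

variable {q t : F} {P : Partition → Sym F}

theorem Mac.vne (M : Mac q t P) (n : ℕ) : vqt q t n ≠ 0 :=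
  mul_ne_zero (Nat.cast_add_one_ne_zero n) (div_ne_zero (M.hq n) (M.ht n))

theorem Mac.hall (M : Mac q t P) (f g : Sym F) : innerQT t t f g = inn vH f g := by
  rw [innerQT_eq]
  congr 1
  funext n
  rw [div_self (M.ht n), mul_one]; rfl

theorem Mac.ortho (M : Mac q t P) (l m : Partition) (h : l ≠ m) : inn (vqt q t) (P l) (P m) = 0 := by
  have := M.mac.1 l m h
  rwa [innerQT_eq] at this

theorem Mac.hself (M : Mac q t P) (l : Partition) : inn vH (P l) (hmon (mv l)) = 1 := by
  have := M.mac.2.1 l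
  rwa [M.hall, hprod_eq] at this

theorem Mac.hlt (M : Mac q t P) (l m : Partition) (h : toColex (mv l) < toColex (mv m)) :
    inn vH (P l) (hmon (mv m)) = 0 := by
  have := M.mac.2.2 l m (fun hd => absurd (dominates_colex l m hd) (not_le.mpr h))
  rwa [M.hall, hprod_eq] at this

theorem Mac.hsize (M : Mac q t P) (l m : Partition) (h : l.size ≠ m.size) :
    inn vH (P l) (hmon (mv m)) = 0 := by
  have := M.mac.2.2 l m (fun hd => h (dominates_size l m hd).symm)
  rwa [M.hall, hprod_eq] at this

theorem hall_nondeg (f : Sym F) (h : ∀ l, inn vH f (hmon (mv l)) = 0) : f = 0 := by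
  apply inn_nondeg vH vH_ne
  intro g
  have hg : g ∈ Submodule.span F (Set.range (hmon (F := F))) := by rw [hmon_span]; trivial
  induction hg using Submodule.span_induction with
  | mem x hx =>
    obtain ⟨k, rfl⟩ := hx
    obtain ⟨l, rfl⟩ := mv_surjective k
    exact h l
  | zero => simp [inn]
  | add x y _ _ hx hy => rw [inn_add_right, hx, hy, add_zero]
  | smul a x _ hx => rw [inn_smul_right, hx, mul_zero]

theorem Mac.isH (M : Mac q t P) (l : Partition) : IsH (P l) l.size := by
  have h : P l - hcomp l.size (P l) = 0 := by
    apply hall_nondeg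
    intro m
    rw [← innB_apply, map_sub, LinearMap.sub_apply, innB_apply, innB_apply]
    by_cases hm : l.size = m.size
    · rw [hm, inn_hcomp vH _ _ _ (hmon_isH m), sub_self]
    · rw [M.hsize l m hm, inn_isH vH _ _ _ _ (weightedHomogeneousComponent_isWeightedHomogeneous _ _) (hmon_isH m) hm,
        sub_zero]
  rw [sub_eq_zero] at h
  rw [h]
  exact weightedHomogeneousComponent_isWeightedHomogeneous _ _

/-- partitions of size `n` -/
def Sz (n : ℕ) : Finset Partition := (size_finite n).toFinset

theorem mem_Sz (n : ℕ) (l : Partition) : l ∈ Sz n ↔ l.size = n := by simp [Sz]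

theorem Mac.span_isH (M : Mac q t P) (f : Sym F) (n : ℕ) (hf : IsH f n) :
    ∃ c : Partition → F, f = ∑ l ∈ Sz n, c l • P l := by
  classical
  let _ : LinearOrder (Sz n) := LinearOrder.lift' (fun l : Sz n => toColex (mv l.1)) (by
    intro a b h
    exact Subtype.ext (mv_injective (toColex.injective h)))
  let A : Matrix (Sz n) (Sz n) F := Matrix.of fun l m => inn vH (P l.1) (hmon (mv m.1))
  have hA : A.det = 1 := by
    rw [Matrix.det_of_isLowerTriangular A]
    · exact Finset.prod_eq_one fun i _ => M.hself i.1
    · intro i j hij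
      exact M.hlt i.1 j.1 hij
  have hu : IsUnit A.det := by rw [hA]; exact isUnit_one
  let b : Sz n → F := fun m => inn vH f (hmon (mv m.1))
  let c : Sz n → F := Matrix.vecMul b A⁻¹
  have hc : Matrix.vecMul c A = b := by
    simp only [c]
    rw [Matrix.vecMul_vecMul, Matrix.nonsing_inv_mul A hu, Matrix.vecMul_one]
  refine ⟨fun l => if h : l ∈ Sz n then c ⟨l, h⟩ else 0, ?_⟩
  rw [← sub_eq_zero]
  apply hall_nondeg
  intro m
  rw [← innB_apply, map_sub, LinearMap.sub_apply, map_sum, LinearMap.sum_apply]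
  simp only [innB_apply, inn_smul_left]
  by_cases hm : m ∈ Sz n
  · have := congrFun hc ⟨m, hm⟩
    rw [Matrix.vecMul, dotProduct] at this
    rw [← Finset.sum_coe_sort, sub_eq_zero]
    refine this.symm.trans (Finset.sum_congr rfl fun i _ => ?_)
    rw [dif_pos i.2]; rfl
  · rw [mem_Sz] at hm
    rw [inn_isH vH f _ _ _ hf (hmon_isH m) (fun h => hm h.symm), zero_sub, neg_eq_zero]
    refine Finset.sum_eq_zero fun i hi => ?_
    rw [mem_Sz] at hi
    rw [M.hsize i m (fun h => hm (h.symm.trans hi)), mul_zero]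

theorem Mac.span_top (M : Mac q t P) : Submodule.span F (Set.range P) = ⊤ := by
  rw [eq_top_iff]
  intro f _
  induction f using MvPolynomial.induction_on' with
  | monomial d a =>
    obtain ⟨c, hc⟩ := M.span_isH (monomial d a) (wt d) (isWeightedHomogeneous_monomial _ _ _ (wt_eq_weight d))
    rw [hc]
    exact sum_mem fun l _ => Submodule.smul_mem _ _ (Submodule.subset_span ⟨l, rfl⟩)
  | add p q hp hq => exact add_mem (hp trivial) (hq trivial)

theorem Mac.ne_zero (M : Mac q t P) (l : Partition) : P l ≠ 0 := by
  intro h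
  have := M.hself l
  rw [h] at this
  simp [inn] at this

theorem Mac.norm_ne (M : Mac q t P) (l : Partition) : inn (vqt q t) (P l) (P l) ≠ 0 := by
  intro h
  apply M.ne_zero l
  apply inn_nondeg (vqt q t) M.vne
  intro g
  have hg : g ∈ Submodule.span F (Set.range P) := by rw [M.span_top]; trivial
  induction hg using Submodule.span_induction with
  | mem x hx =>
    obtain ⟨m, rfl⟩ := hx
    by_cases hm : l = m
    · rw [← hm, h]
    · exact M.ortho l m hm
  | zero => simp [inn]
  | add x y _ _ hx hy => rw [inn_add_right, hx, hy, add_zero]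
  | smul a x _ hx => rw [inn_smul_right, hx, mul_zero]

theorem Mac.inn_QP (M : Mac q t P) (l m : Partition) : inn (vqt q t) (macQ q t P l) (P m) = if l = m then 1 else 0 := by
  rw [macQ, inn_smul_left, bnorm, innerQT_eq]
  change (inn (vqt q t) (P l) (P l))⁻¹ * _ = _
  split_ifs with h
  · rw [← h, inv_mul_cancel₀ (M.norm_ne l)]
  · rw [M.ortho l m h, mul_zero]

theorem Mac.Q_isH (M : Mac q t P) (l : Partition) : IsH (macQ q t P l) l.size := by
  rw [macQ]
  exact (weightedHomogeneousSubmodule F (fun n : ℕ => n + 1) l.size).smul_mem _ (M.isH l)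

theorem Mac.expand (M : Mac q t P) (f : Sym F) (n : ℕ) (hf : IsH f n) :
    f = ∑ l ∈ Sz n, inn (vqt q t) (macQ q t P l) f • P l := by
  obtain ⟨c, hc⟩ := M.span_isH f n hf
  have : ∀ l ∈ Sz n, inn (vqt q t) (macQ q t P l) f = c l := by
    intro l hl
    rw [hc, ← innB_apply, map_sum]
    simp only [innB_apply, inn_smul_right, M.inn_QP]
    simp [hl]
  rw [Finset.sum_congr rfl fun l hl => by rw [this l hl]]
  exact hc

/-- Triangularity of an operator in the Macdonald basis. -/
theorem Mac.eigen_le (M : Mac q t P) (T Td : Sym F → Sym F) (e : Partition → F)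
    (hadj : ∀ f g, inn vH (T f) g = inn vH f (Td g))
    (htri : ∀ l, Td (hmon (mv l)) - C (e l) * hmon (mv l) ∈ Wup (mv l)) (l : Partition) :
    inn vH (T (P l)) (hmon (mv l)) = e l ∧ ∃ c : Partition →₀ F, (c.sum fun m a => a • P m) = T (P l) ∧
      (∀ m, c m ≠ 0 → toColex (mv m) ≤ toColex (mv l)) ∧
      (∀ m, inn (vqt q t) (T (P l)) (P m) = c m * inn (vqt q t) (P m) (P m)) := by
  classical
  -- pairing with elements above l
  have hW : ∀ m : Partition, toColex (mv l) ≤ toColex (mv m) → ∀ f ∈ Wup (mv m), inn vH (P l) f = 0 := by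
    intro m hm f hf
    rw [Wup] at hf
    induction hf using Submodule.span_induction with
    | mem x hx =>
      obtain ⟨k, hk, rfl⟩ := hx
      obtain ⟨k, rfl⟩ := mv_surjective k
      exact M.hlt l k (lt_of_le_of_lt hm hk)
    | zero => simp [inn]
    | add x y _ _ hx hy => rw [inn_add_right, hx, hy, add_zero]
    | smul a x _ hx => rw [inn_smul_right, hx, mul_zero]
  have hTd : ∀ m : Partition, toColex (mv l) ≤ toColex (mv m) →
      inn vH (T (P l)) (hmon (mv m)) = e m * inn vH (P l) (hmon (mv m)) := by
    intro m hm
    have h1 := hW m hm _ (htri m)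
    rw [hadj, ← sub_eq_zero, ← inn_C_mul_right, ← h1, ← innB_apply, ← innB_apply, ← innB_apply, map_sub]
  have hspan : T (P l) ∈ Submodule.span F (Set.range P) := by rw [M.span_top]; trivial
  obtain ⟨c, hc⟩ := (Finsupp.mem_span_range_iff_exists_finsupp).mp hspan
  have hle : ∀ m, c m ≠ 0 → toColex (mv m) ≤ toColex (mv l) := by
    by_contra hcon
    push Not at hcon
    obtain ⟨m0, hm0, hlt0⟩ := hcon
    obtain ⟨m, hm, hmax⟩ := Finset.exists_max_image c.support (fun m => toColex (mv m)) ⟨m0, Finsupp.mem_support_iff.mpr hm0⟩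
    have hlt : toColex (mv l) < toColex (mv m) := lt_of_lt_of_le hlt0 (hmax m0 (Finsupp.mem_support_iff.mpr hm0))
    have h1 := hTd m hlt.le
    rw [M.hlt l m hlt, mul_zero, ← hc, Finsupp.sum, ← innB_apply, map_sum, LinearMap.sum_apply] at h1
    simp only [innB_apply, inn_smul_left] at h1
    rw [Finset.sum_eq_single m] at h1
    · rw [M.hself, mul_one] at h1
      exact (Finsupp.mem_support_iff.mp hm) h1
    · intro k hk hkm
      have : toColex (mv k) < toColex (mv m) := lt_of_le_of_ne (hmax k hk) (fun h => hkm (mv_injective (toColex.injective h)))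
      rw [M.hlt k m this, mul_zero]
    · intro h; exact absurd hm h
  have hcoef : ∀ m, inn (vqt q t) (T (P l)) (P m) = c m * inn (vqt q t) (P m) (P m) := by
    intro m
    rw [← hc, Finsupp.sum, ← innB_apply, map_sum, LinearMap.sum_apply]
    simp only [innB_apply, inn_smul_left]
    rw [Finset.sum_eq_single m]
    · intro k _ hkm
      rw [M.ortho k m hkm, mul_zero]
    · intro h
      rw [Finsupp.notMem_support_iff.mp h, zero_mul]
  refine ⟨?_, c, hc, hle, hcoef⟩
  rw [hTd l le_rfl, M.hself, mul_one]

/-- Eigenvector property for an operator that is self-adjoint and triangular. -/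
theorem Mac.eigen (M : Mac q t P) (T Td : Sym F → Sym F) (e : Partition → F)
    (hself : ∀ f g, inn (vqt q t) (T f) g = inn (vqt q t) f (T g))
    (hadj : ∀ f g, inn vH (T f) g = inn vH f (Td g))
    (htri : ∀ l, Td (hmon (mv l)) - C (e l) * hmon (mv l) ∈ Wup (mv l)) (l : Partition) :
    T (P l) = C (e l) * P l := by
  obtain ⟨h1, c, hc, hle, hcoef⟩ := M.eigen_le T Td e hadj htri l
  have hz : ∀ m, m ≠ l → c m = 0 := by
    intro m hm
    by_contra hcm
    obtain ⟨-, c', hc', hle', hcoef'⟩ := M.eigen_le T Td e hadj htri m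
    have h2 := hcoef' l
    rw [hself, inn_comm, hcoef m] at h2
    have h3 : c' l ≠ 0 := by
      intro h
      rw [h, zero_mul] at h2
      exact mul_ne_zero hcm (M.norm_ne m) h2
    exact hm (mv_injective (toColex.injective (le_antisymm (hle m hcm) (hle' l h3))))
  have h4 : T (P l) = c l • P l := by
    rw [← hc, Finsupp.sum, Finset.sum_eq_single l]
    · intro m _ hm
      rw [hz m hm, zero_smul]
    · intro h
      rw [Finsupp.notMem_support_iff.mp h, zero_smul]
  rw [h4, inn_smul_left, M.hself, mul_one] at h1
  rw [h4, h1, smul_eq_C_mul]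

theorem gen_rescale (u : ℕ → F) (c : F) (k : ℕ) : gen (fun n => c ^ (n + 1) * u n) k = C (c ^ k) * gen u k := by
  have h : genSer (fun n => c ^ (n + 1) * u n) = PowerSeries.rescale (C c) (genSer u) := by
    rw [genSer, genSer, exSer_rescale]
    congr 1
    funext n
    simp only [map_mul, map_pow]; ring
  rw [gen, h, PowerSeries.coeff_rescale, map_pow]; rfl

theorem vop_rescale (u α : ℕ → F) (c : F) (hc : c ≠ 0) (k : ℕ) (f : Sym F) :
    vop (fun n => c ^ (n + 1) * u n) (fun n => (c ^ (n + 1))⁻¹ * α n) k f = C (c ^ k) * vop u α k f := by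
  induction f using MvPolynomial.induction_on generalizing k with
  | C a =>
    rw [show (C a : Sym F) = C a * 1 by simp, vop_C_mul, vop_C_mul, vop_one, vop_one, gen_rescale]; ring
  | add p q hp hq => rw [vop_add, hp, hq, vop_add, mul_add]
  | mul_X p n hp =>
    rw [mul_comm p, vop_X_mul, vop_X_mul, hp, hp, map_mul, mul_add]
    congr 1
    · ring
    · have : (C (c ^ (k + (n + 1))) : Sym F) = C (c ^ (n + 1)) * C (c ^ k) := by rw [← C_mul]; congr 1; ring
      rw [this]
      have h2 : (C ((c ^ (n + 1))⁻¹) * C (c ^ (n + 1)) : Sym F) = 1 := by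
        rw [← C_mul, inv_mul_cancel₀ (pow_ne_zero _ hc), C_1]
      linear_combination (C (α n) * C (c ^ k) * vop u α (k + (n + 1)) p) * h2

/-- the Macdonald operator -/
def TT (p s : F) (k : ℕ) (f : Sym F) : Sym F := vop (fun n => 1 - s ^ (n + 1)) (fun n => p ^ (n + 1) - 1) k f

theorem TT_self (p s c : F) (v : ℕ → F) (hc : c ≠ 0)
    (h1 : ∀ n, v n * (1 - s ^ (n + 1)) = ((n : F) + 1) * ((c ^ (n + 1))⁻¹ * (p ^ (n + 1) - 1)))
    (h2 : ∀ n, v n * (c ^ (n + 1) * (1 - s ^ (n + 1))) = ((n : F) + 1) * (p ^ (n + 1) - 1)) (f g : Sym F) :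
    inn v (TT p s 0 f) g = inn v f (TT p s 0 g) := by
  unfold TT
  rw [inn_vop v _ _ _ _ h1 h2, vop_rescale _ _ c hc]
  simp

theorem Mac.eig (M : Mac q t P) (l : Partition) : TT q t⁻¹ 0 (P l) = C (ev q t⁻¹ l) * P l := by
  have hq := M.hq
  have ht := M.ht
  have t0 := M.t0
  apply M.eigen _ (vop (fun n => q ^ (n + 1) - 1) (fun n => 1 - t⁻¹ ^ (n + 1)) 0) _ _ _ (tri q t⁻¹)
  · apply TT_self q t⁻¹ t _ t0
    · intro n
      have := ht n
      have h0 : t ^ (n + 1) ≠ 0 := pow_ne_zero _ t0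
      rw [vqt, inv_pow]
      field_simp
      ring
    · intro n
      have := ht n
      have h0 : t ^ (n + 1) ≠ 0 := pow_ne_zero _ t0
      rw [vqt, inv_pow]
      field_simp
      ring
  · exact inn_vop _ _ _ _ _ (fun n => rfl) (fun n => rfl)

theorem Mac.eig' (M : Mac q t P) (l : Partition) : TT q⁻¹ t 0 (P l) = C (ev q⁻¹ t l) * P l := by
  have hq := M.hq
  have ht := M.ht
  have q0 := M.q0
  apply M.eigen _ (vop (fun n => q⁻¹ ^ (n + 1) - 1) (fun n => 1 - t ^ (n + 1)) 0) _ _ _ (tri q⁻¹ t)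
  · apply TT_self q⁻¹ t q⁻¹ _ (inv_ne_zero q0)
    · intro n
      have := ht n
      have h0 : q ^ (n + 1) ≠ 0 := pow_ne_zero _ q0
      rw [vqt, inv_pow]
      field_simp
    · intro n
      have := ht n
      have h0 : q ^ (n + 1) ≠ 0 := pow_ne_zero _ q0
      rw [vqt, inv_pow]
      field_simp
  · exact inn_vop _ _ _ _ _ (fun n => rfl) (fun n => rfl)

end Mac

/-! ### Cells of the diagram -/

section Cells

/-- the cells of a partition -/
def cells (l : Partition) : Finset (Σ _ : ℕ, ℕ) := l.part.support.sigma fun j => Finset.range (l.part j)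

theorem mem_cells (l : Partition) (x : Σ _ : ℕ, ℕ) : x ∈ cells l ↔ x.2 < l.part x.1 := by
  simp only [cells, Finset.mem_sigma, Finsupp.mem_support_iff, Finset.mem_range]
  omega

theorem card_cells (l : Partition) : (cells l).card = l.size := by
  simp [cells, Partition.size, Finsupp.sum]

theorem cells_subset (l m : Partition) : cells m ⊆ cells l ↔ m ≤ l := by
  constructor
  · intro h j
    by_contra hc
    push Not at hc
    have := h ((mem_cells m ⟨j, l.part j⟩).mpr hc)
    rw [mem_cells] at this
    exact lt_irrefl _ this
  · intro h x hx
    rw [mem_cells] at hx ⊢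
    exact lt_of_lt_of_le hx (h x.1)

theorem cells_inj (l m : Partition) (h : cells l = cells m) : l = m := by
  apply Partition.ext'
  intro j
  exact le_antisymm ((cells_subset m l).mp h.subset j) ((cells_subset l m).mp h.symm.subset j)

/-- sum of contents -/
def xi (p s : F) (l : Partition) : F := ∑ x ∈ cells l, p ^ x.2 * s ^ x.1

theorem ev_eq (p s : F) (l : Partition) : ev p s l = 1 - (1 - s) * (1 - p) * xi p s l := by
  have h : ∀ n : ℕ, p ^ n - 1 = -((1 - p) * ∑ j ∈ Finset.range n, p ^ j) := by
    intro n
    have := mul_neg_geom_sum p n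
    rw [this]; ring
  rw [ev, xi, cells, Finset.sum_sigma]
  simp only [h, ← Finset.sum_mul]
  rw [mul_assoc, Finset.mul_sum (a := (1 - p)), sub_eq_add_neg (1 : F) ((1 - s) * _), ← mul_neg, ← Finset.sum_neg_distrib]
  congr 2
  refine Finset.sum_congr rfl fun j _ => ?_
  ring

theorem qtPoch_eq (q t a : F) (l : Partition) : qtPoch q t a l = ∏ x ∈ cells l, (1 - a * (q ^ x.2 * t⁻¹ ^ x.1)) := by
  rw [cells, Finset.prod_sigma, qtPoch]
  refine Finset.prod_congr rfl fun j _ => ?_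
  rw [qPochN]
  refine Finset.prod_congr rfl fun i _ => ?_
  rw [zpow_neg, zpow_natCast, inv_pow]
  ring

/-- genericity: constant term functional -/
def Gen (q t : F) [CharZero F] : Prop :=
  ∃ g : F →ₗ[ℚ] ℚ, ∀ i j : ℤ, g (q ^ i * t ^ j) = if i = 0 ∧ j = 0 then 1 else 0

variable [CharZero F]

open Classical in
/-- signed indicator -/
def sgnd (l m : Partition) (c : Σ _ : ℕ, ℕ) : ℚ := (if c ∈ cells l then 1 else 0) - (if c ∈ cells m then 1 else 0)

theorem sum_sgnd {M : Type*} [AddCommGroup M] [Module ℚ M] (l m : Partition) (w : (Σ _ : ℕ, ℕ) → M) :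
    ∑ c ∈ cells l ∪ cells m, sgnd l m c • w c = ∑ c ∈ cells l, w c - ∑ c ∈ cells m, w c := by
  classical
  simp only [sgnd, sub_smul, Finset.sum_sub_distrib, ite_smul, one_smul, zero_smul]
  rw [← Finset.sum_filter, ← Finset.sum_filter]
  congr 2
  · ext c; simp only [Finset.mem_filter, Finset.mem_union]; tauto
  · ext c; simp only [Finset.mem_filter, Finset.mem_union]; tauto

theorem gen_key (q t : F) (q0 : q ≠ 0) (t0 : t ≠ 0) (g : F →ₗ[ℚ] ℚ) (hg : ∀ i j : ℤ, g (q ^ i * t ^ j) = if i = 0 ∧ j = 0 then 1 else 0)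
    (l m : Partition) :
    g ((xi q t⁻¹ l - xi q t⁻¹ m) * (xi q⁻¹ t l - xi q⁻¹ t m)) = ∑ c ∈ cells l ∪ cells m, sgnd l m c ^ 2 := by
  classical
  rw [xi, xi, xi, xi, ← sum_sgnd, ← sum_sgnd, Finset.sum_mul_sum, map_sum]
  refine Finset.sum_congr rfl fun c hc => ?_
  rw [map_sum, Finset.sum_eq_single c]
  · rw [smul_mul_smul_comm, map_smul]
    have : q ^ c.2 * t⁻¹ ^ c.1 * (q⁻¹ ^ c.2 * t ^ c.1) = q ^ (0 : ℤ) * t ^ (0 : ℤ) := by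
      rw [inv_pow, inv_pow]; field_simp
      try simp
    rw [this, hg]
    simp [sq]
  · intro d _ hd
    rw [smul_mul_smul_comm, map_smul]
    have : q ^ c.2 * t⁻¹ ^ c.1 * (q⁻¹ ^ d.2 * t ^ d.1) = q ^ ((c.2 : ℤ) - d.2) * t ^ ((d.1 : ℤ) - c.1) := by
      rw [zpow_sub₀ q0, zpow_sub₀ t0]
      simp only [zpow_natCast, inv_pow]; field_simp
    rw [this, hg, if_neg, smul_zero]
    rintro ⟨h1, h2⟩
    apply hd
    obtain ⟨c1, c2⟩ := c
    obtain ⟨d1, d2⟩ := d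
    simp at h1 h2 ⊢
    omega
  · intro h; exact absurd hc h

theorem xi_inj (q t : F) (q0 : q ≠ 0) (t0 : t ≠ 0) (G : Gen q t) (l m : Partition) (h : xi q t⁻¹ l = xi q t⁻¹ m) : l = m := by
  classical
  obtain ⟨g, hg⟩ := G
  have := gen_key q t q0 t0 g hg l m
  rw [h, sub_self, zero_mul, map_zero] at this
  have h2 := (Finset.sum_eq_zero_iff_of_nonneg (fun c _ => sq_nonneg _)).mp this.symm
  apply cells_inj
  ext c
  by_cases hc : c ∈ cells l ∪ cells m
  · have h3 := h2 c hc
    rw [sgnd] at h3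
    split_ifs at h3 with h4 h5 h5
    · exact iff_of_true h4 h5
    · norm_num at h3
    · norm_num at h3
    · exact iff_of_false h4 h5
  · rw [Finset.mem_union] at hc; tauto

/-- covering relation with given box weight -/
def Cov (l m : Partition) : Prop :=
  l.size = m.size + 1 ∧ m ≤ l ∧ ∃ b, b ∉ cells m ∧ cells l = insert b (cells m)

theorem cov_of (q t : F) (q0 : q ≠ 0) (t0 : t ≠ 0) (G : Gen q t) (l m : Partition) (hs : l.size = m.size + 1)
    (h : (xi q t⁻¹ l - xi q t⁻¹ m) * (xi q⁻¹ t l - xi q⁻¹ t m) = 1) : Cov l m := by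
  classical
  obtain ⟨g, hg⟩ := G
  have h1 := gen_key q t q0 t0 g hg l m
  have h0 := hg 0 0
  simp at h0
  rw [h, h0] at h1
  have h2 := sum_sgnd l m (fun _ => (1 : ℚ))
  simp only [smul_eq_mul, mul_one, Finset.sum_const, nsmul_eq_mul, card_cells, hs] at h2
  push_cast at h2
  have h3 : ∑ c ∈ cells l ∪ cells m, (sgnd l m c ^ 2 - sgnd l m c) = 0 := by
    rw [Finset.sum_sub_distrib, ← h1, h2]; ring
  have hn : ∀ c, 0 ≤ sgnd l m c ^ 2 - sgnd l m c := by
    intro c; rw [sgnd]; split_ifs <;> norm_num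
  have h4 := (Finset.sum_eq_zero_iff_of_nonneg (fun c _ => hn c)).mp h3
  have h5 : cells m ⊆ cells l := by
    intro c hc
    by_contra hc'
    have := h4 c (Finset.mem_union_right _ hc)
    rw [sgnd, if_pos hc, if_neg hc'] at this
    norm_num at this
  refine ⟨hs, (cells_subset l m).mp h5, ?_⟩
  have h6 : (cells l \ cells m).card = 1 := by
    rw [Finset.card_sdiff_of_subset h5, card_cells, card_cells]; omega
  obtain ⟨b, hb⟩ := Finset.card_eq_one.mp h6
  refine ⟨b, ?_, ?_⟩
  · have : b ∈ cells l \ cells m := by rw [hb]; simp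
    exact (Finset.mem_sdiff.mp this).2
  · rw [Finset.insert_eq, ← hb, Finset.sdiff_union_of_subset h5]

theorem Cov.poch (q t : F) {l m : Partition} (h : Cov l m) (a : F) :
    qtPoch q t a l = qtPoch q t a m * (1 - a * (xi q t⁻¹ l - xi q t⁻¹ m)) := by
  obtain ⟨_, _, b, hb, hc⟩ := h
  rw [qtPoch_eq, qtPoch_eq, xi, xi, hc, Finset.prod_insert hb, Finset.sum_insert hb]
  ring

end Cells

/-! ### Operator relations -/

section Oper
open MvPolynomial
variable [CharZero F]

theorem coeff_two (A : PowerSeries F) (b d e f K : F) (hef : e * f = b * d) (hK : K * (b - d) = b + d - e - f)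
    (h : A * ((1 - PowerSeries.C b * PowerSeries.X) * (1 - PowerSeries.C d * PowerSeries.X)) =
      (1 - PowerSeries.C e * PowerSeries.X) * (1 - PowerSeries.C f * PowerSeries.X)) (m : ℕ) :
    PowerSeries.coeff (m + 1) A = K * (b ^ (m + 1) - d ^ (m + 1)) := by
  have hg : ∀ a : F, PowerSeries.mk (fun n => a ^ n) * (1 - PowerSeries.C a * PowerSeries.X) = 1 := by
    intro a
    ext n
    rw [mul_sub, mul_one, mul_left_comm, map_sub, PowerSeries.coeff_C_mul]
    cases n with
    | zero => simp
    | succ n =>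
      rw [PowerSeries.coeff_succ_mul_X, PowerSeries.coeff_mk, PowerSeries.coeff_mk, PowerSeries.coeff_one]
      simp [pow_succ]; ring
  have hne : ∀ a : F, (1 - PowerSeries.C a * PowerSeries.X) ≠ 0 := fun a h0 => by
    have := hg a
    rw [h0, mul_zero] at this
    exact zero_ne_one this
  have hA : A = 1 + PowerSeries.C K * (PowerSeries.mk (fun n => b ^ n) - PowerSeries.mk (fun n => d ^ n)) := by
    apply mul_right_cancel₀ (mul_ne_zero (hne b) (hne d))
    rw [h]
    have h1 := hg b
    have h2 := hg d
    have h3 := congrArg (PowerSeries.C (R := F)) hef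
    have h4 := congrArg (PowerSeries.C (R := F)) hK
    simp only [map_mul, map_sub, map_add] at h3 h4
    linear_combination PowerSeries.X ^ 2 * h3 - PowerSeries.X * h4
      - PowerSeries.C K * (1 - PowerSeries.C d * PowerSeries.X) * h1 + PowerSeries.C K * (1 - PowerSeries.C b * PowerSeries.X) * h2
  rw [hA, map_add, PowerSeries.coeff_C_mul, map_sub, PowerSeries.coeff_mk, PowerSeries.coeff_mk, PowerSeries.coeff_one]
  simp

theorem exSer_four (b d e f : F) :
    exSer (fun n => b ^ (n + 1) + d ^ (n + 1) - e ^ (n + 1) - f ^ (n + 1)) *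
      ((1 - PowerSeries.C b * PowerSeries.X) * (1 - PowerSeries.C d * PowerSeries.X)) =
      (1 - PowerSeries.C e * PowerSeries.X) * (1 - PowerSeries.C f * PowerSeries.X) := by
  have h1 := exSer_geom b
  have h2 := exSer_geom d
  have h3 := exSer_geom e
  have h4 := exSer_geom f
  have h5 : exSer (fun n => b ^ (n + 1) + d ^ (n + 1) - e ^ (n + 1) - f ^ (n + 1)) *
      (exSer (fun n => e ^ (n + 1)) * exSer (fun n => f ^ (n + 1))) =
      exSer (fun n => b ^ (n + 1)) * exSer (fun n => d ^ (n + 1)) := by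
    rw [← exSer_add, ← exSer_add, ← exSer_add]
    congr 1
    funext n
    ring
  set A := exSer (fun n => b ^ (n + 1) + d ^ (n + 1) - e ^ (n + 1) - f ^ (n + 1))
  set B := exSer (fun n => b ^ (n + 1))
  set D := exSer (fun n => d ^ (n + 1))
  set E := exSer (fun n => e ^ (n + 1))
  set G := exSer (fun n => f ^ (n + 1))
  set b' := (1 - PowerSeries.C b * PowerSeries.X)
  set d' := (1 - PowerSeries.C d * PowerSeries.X)
  set e' := (1 - PowerSeries.C e * PowerSeries.X)
  set f' := (1 - PowerSeries.C f * PowerSeries.X)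
  calc A * (b' * d') = A * (b' * d') * ((E * e') * (G * f')) := by rw [h3, h4]; ring
    _ = (A * (E * G)) * (b' * d') * (e' * f') := by ring
    _ = (B * b') * (D * d') * (e' * f') := by rw [h5]; ring
    _ = e' * f' := by rw [h1, h2]; ring

theorem TT_X_mul (p s : F) (k n : ℕ) (f : Sym F) :
    TT p s k (X n * f) = X n * TT p s k f + C (p ^ (n + 1) - 1) * TT p s (k + (n + 1)) f := vop_X_mul _ _ _ _ _

theorem TT_C_mul (p s : F) (k : ℕ) (c : F) (f : Sym F) : TT p s k (C c * f) = C c * TT p s k f := vop_C_mul _ _ _ _ _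
theorem TT_add (p s : F) (k : ℕ) (f g : Sym F) : TT p s k (f + g) = TT p s k f + TT p s k g := vop_add _ _ _ _ _

/-- `∑_i g⁻_i z^{n-i} g_{n-i}` -/
def HH (t z : F) (n : ℕ) : Sym F := ∑ i ∈ Finset.range (n + 1),
  gen (fun m => 1 - t ^ (m + 1)) i * (C (z ^ (n - i)) * gen (fun m => 1 - t⁻¹ ^ (m + 1)) (n - i))

theorem HH_t (t : F) (t0 : t ≠ 0) (n : ℕ) : HH t t (n + 1) = 0 := by
  have h : genSer (fun m => 1 - t ^ (m + 1)) * genSer (fun m => t ^ (m + 1) * (1 - t⁻¹ ^ (m + 1))) = 1 := by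
    rw [genSer, genSer, ← exSer_add, ← exSer_zero]
    congr 1
    funext m
    rw [← add_mul, ← map_add]
    have : 1 - t ^ (m + 1) + t ^ (m + 1) * (1 - t⁻¹ ^ (m + 1)) = 0 := by
      rw [inv_pow]; field_simp; ring
    rw [this]; simp
  have h2 := congrArg (PowerSeries.coeff (n + 1)) h
  rw [PowerSeries.coeff_mul, Finset.Nat.sum_antidiagonal_eq_sum_range_succ_mk, PowerSeries.coeff_one, if_neg (by omega)] at h2
  rw [← h2, HH]
  refine Finset.sum_congr rfl fun i _ => ?_
  rw [← gen_rescale]; rfl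

theorem comm_base (q t K : F) (q0 : q ≠ 0) (t0 : t ≠ 0) (hqt : q ≠ t) (hK : K * (t - q) = (1 - q) * (t - 1)) (j k : ℕ) (hn : 1 ≤ j + k) :
    TT q⁻¹ t j (TT q t⁻¹ k 1) - TT q t⁻¹ k (TT q⁻¹ t j 1) = C (K * q⁻¹ ^ k) * HH t q (j + k) := by
  have hc : ∀ m, PowerSeries.coeff (m + 1) (exSer fun n => (1 - t⁻¹ ^ (n + 1)) * (q⁻¹ ^ (n + 1) - 1)) =
      K * (q⁻¹ ^ (m + 1) - t⁻¹ ^ (m + 1)) := by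
    intro m
    apply coeff_two _ q⁻¹ t⁻¹ 1 (t⁻¹ * q⁻¹)
    · ring
    · field_simp; linear_combination hK
    · rw [← exSer_four q⁻¹ t⁻¹ 1 (t⁻¹ * q⁻¹)]
      refine congrArg (fun h => exSer h * _) (funext fun n => ?_)
      rw [mul_pow]; ring
  have hc' : ∀ m, PowerSeries.coeff (m + 1) (exSer fun n => (1 - t ^ (n + 1)) * (q ^ (n + 1) - 1)) =
      (-K) * (q ^ (m + 1) - t ^ (m + 1)) := by
    intro m
    apply coeff_two _ q t 1 (t * q)
    · ring
    · linear_combination hK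
    · rw [← exSer_four q t 1 (t * q)]
      refine congrArg (fun h => exSer h * _) (funext fun n => ?_)
      rw [mul_pow]; ring
  set g : ℕ → Sym F := gen (fun m => 1 - t⁻¹ ^ (m + 1)) with hg
  set g' : ℕ → Sym F := gen (fun m => 1 - t ^ (m + 1)) with hg'
  have h1 : TT q⁻¹ t j (TT q t⁻¹ k 1) = ∑ m ∈ Finset.range k, C (K * (q⁻¹ ^ (m + 1) - t⁻¹ ^ (m + 1))) * (g (k - (m + 1)) * g' (j + (m + 1))) + g k * g' j := by
    rw [TT, TT, vop_one, vop, trans_gen, map_sum, Finset.sum_range_succ']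
    congr 1
    · refine Finset.sum_congr rfl fun m _ => ?_
      rw [hc, pairing_C_mul, pairing_C_mul, pairing_X_pow]; ring
    · rw [exSer_coeff_zero, pairing_C_mul, pairing_C_mul, pairing_X_pow, map_one, one_mul, Nat.sub_zero, add_zero]
  have h2 : TT q t⁻¹ k (TT q⁻¹ t j 1) = ∑ m ∈ Finset.range j, C ((-K) * (q ^ (m + 1) - t ^ (m + 1))) * (g' (j - (m + 1)) * g (k + (m + 1))) + g' j * g k := by
    rw [TT, TT, vop_one, vop, trans_gen, map_sum, Finset.sum_range_succ']
    congr 1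
    · refine Finset.sum_congr rfl fun m _ => ?_
      rw [hc', pairing_C_mul, pairing_C_mul, pairing_X_pow]; ring
    · rw [exSer_coeff_zero, pairing_C_mul, pairing_C_mul, pairing_X_pow, map_one, one_mul, Nat.sub_zero, add_zero]
  have h3 : C (K * q⁻¹ ^ k) * HH t q (j + k) = C (K * q⁻¹ ^ k) * HH t q (j + k) - C (K * t⁻¹ ^ k) * HH t t (j + k) := by
    obtain ⟨n, hn⟩ : ∃ n, j + k = n + 1 := ⟨j + k - 1, by omega⟩
    rw [hn, HH_t t t0]; ring
  have h4 : C (K * q⁻¹ ^ k) * HH t q (j + k) - C (K * t⁻¹ ^ k) * HH t t (j + k) =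
      ∑ i ∈ Finset.range (j + (k + 1)), C (K * (q⁻¹ ^ k * q ^ (j + k - i) - t⁻¹ ^ k * t ^ (j + k - i))) * (g' i * g (j + k - i)) := by
    rw [HH, HH, Finset.mul_sum, Finset.mul_sum, ← Finset.sum_sub_distrib]
    refine Finset.sum_congr rfl fun i _ => ?_
    simp only [map_mul, map_sub]; ring
  rw [h3, h4, h1, h2, Finset.sum_range_add, Finset.sum_range_succ' _ k, ← Finset.sum_range_reflect (fun i => C (K * (q⁻¹ ^ k * q ^ (j + k - i) - t⁻¹ ^ k * t ^ (j + k - i))) * (g' i * g (j + k - i))) j]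
  have e1 : ∀ z : F, z ≠ 0 → ∀ m, z⁻¹ ^ k * z ^ (k + m) = z ^ m := by
    intro z hz m
    rw [pow_add, inv_pow]; field_simp
  have e2 : ∀ z : F, z ≠ 0 → ∀ m, m ≤ k → z⁻¹ ^ k * z ^ (k - m) = z⁻¹ ^ m := by
    intro z hz m hm
    obtain ⟨r, rfl⟩ := Nat.exists_eq_add_of_le hm
    rw [Nat.add_sub_cancel_left, pow_add, inv_pow, inv_pow]; field_simp
  have h5 : ∀ m ∈ Finset.range j, C (K * (q⁻¹ ^ k * q ^ (j + k - (j - 1 - m)) - t⁻¹ ^ k * t ^ (j + k - (j - 1 - m)))) * (g' (j - 1 - m) * g (j + k - (j - 1 - m)))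
      = - (C ((-K) * (q ^ (m + 1) - t ^ (m + 1))) * (g' (j - (m + 1)) * g (k + (m + 1)))) := by
    intro m hm
    rw [Finset.mem_range] at hm
    rw [show j + k - (j - 1 - m) = k + (m + 1) by omega, e1 q q0, e1 t t0, show j - 1 - m = j - (m + 1) by omega]
    simp only [map_mul, map_neg]; ring
  have h6 : ∀ m ∈ Finset.range k, C (K * (q⁻¹ ^ k * q ^ (j + k - (j + (m + 1))) - t⁻¹ ^ k * t ^ (j + k - (j + (m + 1))))) * (g' (j + (m + 1)) * g (j + k - (j + (m + 1))))
      = C (K * (q⁻¹ ^ (m + 1) - t⁻¹ ^ (m + 1))) * (g (k - (m + 1)) * g' (j + (m + 1))) := by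
    intro m hm
    rw [Finset.mem_range] at hm
    rw [show j + k - (j + (m + 1)) = k - (m + 1) by omega, e2 q q0 _ (by omega), e2 t t0 _ (by omega)]
    ring
  rw [Finset.sum_congr rfl h5, Finset.sum_congr rfl h6, Finset.sum_neg_distrib]
  rw [show j + k - (j + 0) = k + 0 by omega, e1 q q0, e1 t t0]
  simp only [pow_zero, sub_self, mul_zero, map_zero, zero_mul]
  ring

theorem TT_comm (q t K : F) (q0 : q ≠ 0) (t0 : t ≠ 0) (hqt : q ≠ t) (hK : K * (t - q) = (1 - q) * (t - 1)) (j k : ℕ) (hn : 1 ≤ j + k) (f : Sym F) :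
    TT q⁻¹ t j (TT q t⁻¹ k f) - TT q t⁻¹ k (TT q⁻¹ t j f) = C (K * q⁻¹ ^ k) * HH t q (j + k) * f := by
  induction f using MvPolynomial.induction_on generalizing j k with
  | C a =>
    rw [show (C a : Sym F) = C a * 1 by simp, TT_C_mul, TT_C_mul, TT_C_mul, TT_C_mul, ← mul_sub, comm_base q t K q0 t0 hqt hK j k hn]; ring
  | add f g hf hg => 
    simp only [TT_add]
    linear_combination hf j k hn + hg j k hn
  | mul_X f n hf =>
    rw [mul_comm f]
    simp only [TT_X_mul, TT_add, TT_C_mul]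
    have a := hf j k hn
    have b := hf (j + (n + 1)) k (by omega)
    have c := hf j (k + (n + 1)) (by omega)
    rw [show j + (n + 1) + k = j + (k + (n + 1)) by omega] at b
    have e : (C (q⁻¹ ^ (n + 1) - 1) * C (K * q⁻¹ ^ k) + C (q ^ (n + 1) - 1) * C (K * q⁻¹ ^ (k + (n + 1))) : Sym F) = 0 := by
      rw [← map_mul, ← map_mul, ← map_add, ← map_zero C]
      congr 1
      simp only [inv_pow]
      field_simp
      ring
    linear_combination X n * a + C (q⁻¹ ^ (n + 1) - 1) * b + C (q ^ (n + 1) - 1) * c + HH t q (j + (k + (n + 1))) * f * e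

theorem gen_one (u : ℕ → F) : gen u 1 = C (u 0) * X 0 := by
  have := gen_succ u 0
  simpa [gen_zero] using this

theorem TT_comm1 (q t : F) (q0 : q ≠ 0) (t0 : t ≠ 0) (hqt : q ≠ t) (f : Sym F) :
    TT q⁻¹ t 0 (TT q t⁻¹ 1 f) - TT q t⁻¹ 1 (TT q⁻¹ t 0 f) = C (q⁻¹ * (1 - q) * (1 - t⁻¹) * (1 - t)) * (X 0 * f) := by
  have hs : t - q ≠ 0 := sub_ne_zero.mpr hqt.symm
  rw [TT_comm q t ((1 - q) * (t - 1) / (t - q)) q0 t0 hqt (by field_simp) 0 1 (by norm_num)]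
  rw [HH, Finset.sum_range_succ, Finset.sum_range_one]
  simp only [zero_add, Nat.sub_self, Nat.sub_zero, gen_zero, gen_one, pow_one, pow_zero, map_one]
  have : (C ((1 - q) * (t - 1) / (t - q) * q⁻¹) * (C q * C (1 - t⁻¹) + C (1 - t)) : Sym F) = C (q⁻¹ * (1 - q) * (1 - t⁻¹) * (1 - t)) := by
    rw [← map_mul, ← map_add, ← map_mul]
    congr 1
    field_simp
    ring
  linear_combination X 0 * f * this

end Oper

/-! ### Matrix elements in the Macdonald basis -/

section Mat
open MvPolynomial
variable [CharZero F]
variable {q t : F} {P : Partition → Sym F}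

/-- the generating functions -/
def FF (q a b : F) (k : ℕ) : Sym F := gen (fun n => (a ^ (n + 1) - b ^ (n + 1)) / (1 - q ^ (n + 1))) k

theorem FF_trans (hq : ∀ n : ℕ, 1 - q ^ (n + 1) ≠ 0) (a b : F) (n : ℕ) :
    trans (fun n => q ^ (n + 1) - 1) (FF q a b (n + 1)) - Polynomial.C (C b) * (Polynomial.X ^ 1 * trans (fun n => q ^ (n + 1) - 1) (FF q a b n))
      = Polynomial.C (FF q a b (n + 1)) - Polynomial.C (C a * FF q a b n) * Polynomial.X ^ 1 := by
  have hs : exSer (fun n => (a ^ (n + 1) - b ^ (n + 1)) / (1 - q ^ (n + 1)) * (q ^ (n + 1) - 1)) * (1 - PowerSeries.C b * PowerSeries.X)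
      = 1 - PowerSeries.C a * PowerSeries.X := by
    have h := exSer_four b 0 a 0
    simp only [map_zero, zero_mul, sub_zero, mul_one] at h
    rw [← h]
    refine congrArg (fun h => exSer h * _) (funext fun n => ?_)
    have := hq n
    field_simp
    simp
    ring
  have h0 := exSer_coeff_zero (fun n => (a ^ (n + 1) - b ^ (n + 1)) / (1 - q ^ (n + 1)) * (q ^ (n + 1) - 1))
  have h1 := coeff_of_mul_one_sub _ _ _ hs
  rw [FF, FF, trans_gen, trans_gen]
  set c := fun m => PowerSeries.coeff m (exSer (fun n => (a ^ (n + 1) - b ^ (n + 1)) / (1 - q ^ (n + 1)) * (q ^ (n + 1) - 1))) with hc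
  have h0 : c 0 = 1 := h0
  have h1 : ∀ m, c (m + 1) = (b - a) * b ^ m := h1
  change (∑ m ∈ Finset.range (n + 1 + 1), Polynomial.C (gen _ (n + 1 - m)) * (Polynomial.C (C (c m)) * Polynomial.X ^ m)) - _ * (_ * ∑ m ∈ Finset.range (n + 1), Polynomial.C (gen _ (n - m)) * (Polynomial.C (C (c m)) * Polynomial.X ^ m)) = _
  set g := gen (fun n => (a ^ (n + 1) - b ^ (n + 1)) / (1 - q ^ (n + 1)))
  rw [Finset.sum_range_succ' _ (n + 1), h0, Finset.mul_sum, Finset.mul_sum, add_sub_right_comm, ← Finset.sum_sub_distrib]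
  have h2 : ∀ m, (Polynomial.C (g (n + 1 - (m + 1))) * (Polynomial.C (C (c (m + 1))) * Polynomial.X ^ (m + 1)) -
      Polynomial.C (C b) * (Polynomial.X ^ 1 * (Polynomial.C (g (n - m)) * (Polynomial.C (C (c m)) * Polynomial.X ^ m))))
      = Polynomial.C (g (n - m) * C (c (m + 1) - b * c m)) * Polynomial.X ^ (m + 1) := by
    intro m
    rw [Nat.add_sub_add_right]
    simp only [map_mul, map_sub]
    ring
  simp only [h2]
  rw [Finset.sum_range_succ', Finset.sum_eq_zero]
  · simp only [h1, h0, Nat.sub_zero, zero_add, pow_zero, mul_one, map_one]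
    simp only [map_sub, map_mul]
    ring
  · intro m _
    rw [h1, h1, show (b - a) * b ^ (m + 1) - b * ((b - a) * b ^ m) = 0 by ring]
    simp

theorem FF_rel (hq : ∀ n : ℕ, 1 - q ^ (n + 1) ≠ 0) (s a b : F) (n : ℕ) (f : Sym F) :
    TT q s 0 (FF q a b (n + 1) * f) - C b * TT q s 1 (FF q a b n * f) =
      FF q a b (n + 1) * TT q s 0 f - C a * (FF q a b n * TT q s 1 f) := by
  have h := FF_trans hq a b n
  have h2 := congrArg (fun z => pairing (fun j => gen (fun n => 1 - s ^ (n + 1)) (0 + j)) (z * trans (fun n => q ^ (n + 1) - 1) f)) h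
  simp only [sub_mul, map_sub] at h2
  simp only [mul_assoc, pairing_C_mul, pairing_X_pow_mul] at h2
  simp only [TT, vop, map_mul]
  simp only [zero_add] at h2 ⊢
  simp only [add_comm 1]
  simpa [mul_assoc] using h2

theorem FF_isH (a b : F) (k : ℕ) : IsH (FF q a b k) k := gen_isH _ _

theorem FF_zero (a b : F) : FF q a b 0 = 1 := gen_zero _

theorem FF_rescale (a b z : F) (k : ℕ) : FF q (z * a) (z * b) k = C (z ^ k) * FF q a b k := by
  rw [FF, FF, ← gen_rescale]
  congr 1
  funext n
  rw [mul_pow, mul_pow]; ring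

/-- matrix element of `p_1` -/
def pp (q t : F) (P : Partition → Sym F) (l m : Partition) : F := inn (vqt q t) (macQ q t P l) (X 0 * P m)

/-- matrix elements of multiplication by `FF` -/
def cc (q t : F) (P : Partition → Sym F) (a b : F) (l m : Partition) : F :=
  inn (vqt q t) (macQ q t P l) (FF q a b (l.size - m.size) * P m)

theorem inn_sum_right {ι : Type*} (v : ℕ → F) (f : Sym F) (S : Finset ι) (g : ι → Sym F) :
    inn v f (∑ i ∈ S, g i) = ∑ i ∈ S, inn v f (g i) := by
  rw [← innB_apply, map_sum]; rfl

theorem inn_sub_right (v : ℕ → F) (f g h : Sym F) : inn v f (g - h) = inn v f g - inn v f h := by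
  rw [← innB_apply, map_sub]; rfl

theorem Mac.Qeig_of (M : Mac q t P) (T : Sym F → Sym F) (e : Partition → F) (hadd : ∀ f g, T (f + g) = T f + T g)
    (hC : ∀ c f, T (C c * f) = C c * T f) (he : ∀ l, T (P l) = C (e l) * P l) (l : Partition) (f : Sym F) :
    inn (vqt q t) (macQ q t P l) (T f) = e l * inn (vqt q t) (macQ q t P l) f := by
  have hf : f ∈ Submodule.span F (Set.range P) := by rw [M.span_top]; trivial
  induction hf using Submodule.span_induction with
  | mem x hx =>
    obtain ⟨m, rfl⟩ := hx
    rw [he, inn_C_mul_right, M.inn_QP]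
    split_ifs with h
    · rw [h]
    · ring
  | zero =>
    have := hC 0 0
    rw [map_zero, zero_mul, zero_mul] at this
    rw [this, ← innB_apply, map_zero, mul_zero]
  | add x y _ _ hx hy => rw [hadd, inn_add_right, inn_add_right, hx, hy]; ring
  | smul a x _ hx => rw [smul_eq_C_mul, hC, inn_C_mul_right, inn_C_mul_right, hx]; ring

theorem Mac.Qeig (M : Mac q t P) (l : Partition) (f : Sym F) :
    inn (vqt q t) (macQ q t P l) (TT q t⁻¹ 0 f) = ev q t⁻¹ l * inn (vqt q t) (macQ q t P l) f :=
  M.Qeig_of _ _ (TT_add _ _ _) (TT_C_mul _ _ _) M.eig l f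

theorem Mac.Qeig' (M : Mac q t P) (l : Partition) (f : Sym F) :
    inn (vqt q t) (macQ q t P l) (TT q⁻¹ t 0 f) = ev q⁻¹ t l * inn (vqt q t) (macQ q t P l) f :=
  M.Qeig_of _ _ (TT_add _ _ _) (TT_C_mul _ _ _) M.eig' l f

theorem Mac.q1 (M : Mac q t P) : 1 - q ≠ 0 := by simpa using M.hq 0
theorem Mac.t1 (M : Mac q t P) : 1 - t ≠ 0 := by simpa using M.ht 0
theorem Mac.s1 (M : Mac q t P) : 1 - t⁻¹ ≠ 0 := by
  intro h
  apply M.t1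
  have := M.t0
  field_simp at h
  linear_combination -h

theorem X0_isH : IsH (X 0 : Sym F) 1 := by
  have := isWeightedHomogeneous_X F (fun n : ℕ => n + 1) 0
  simpa using this

theorem Mac.pp_size (M : Mac q t P) (l m : Partition) (h : pp q t P l m ≠ 0) : l.size = m.size + 1 := by
  by_contra hc
  apply h
  apply inn_isH _ _ _ l.size (1 + m.size) (M.Q_isH l) (X0_isH.mul (M.isH m)) (by omega)

theorem Mac.pp_cov (M : Mac q t P) (G : Gen q t) (l m : Partition) (h : pp q t P l m ≠ 0) : Cov l m := by
  have hqt : q ≠ t := by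
    rintro rfl
    obtain ⟨g, hg⟩ := G
    have h1 := hg 1 (-1)
    have h2 := hg 0 0
    have : q ^ (1 : ℤ) * q ^ (-1 : ℤ) = q ^ (0 : ℤ) * q ^ (0 : ℤ) := by
      rw [← zpow_add₀ M.q0, ← zpow_add₀ M.q0]; rfl
    rw [this, h2] at h1
    norm_num at h1
  have a1 : (q - 1) * inn (vqt q t) (macQ q t P l) (TT q t⁻¹ 1 (P m)) = (ev q t⁻¹ l - ev q t⁻¹ m) * pp q t P l m := by
    have h1 := TT_X_mul q t⁻¹ 0 0 (P m)
    rw [M.eig] at h1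
    have h2 := congrArg (inn (vqt q t) (macQ q t P l)) h1
    rw [M.Qeig, inn_add_right, mul_left_comm, inn_C_mul_right, inn_C_mul_right] at h2
    simp only [zero_add, pow_one] at h2
    change _ * pp q t P l m = _ * pp q t P l m + _ at h2
    linear_combination -h2
  have a2 : (ev q⁻¹ t l - ev q⁻¹ t m) * inn (vqt q t) (macQ q t P l) (TT q t⁻¹ 1 (P m)) =
      q⁻¹ * (1 - q) * (1 - t⁻¹) * (1 - t) * pp q t P l m := by
    have h1 := TT_comm1 q t M.q0 M.t0 hqt (P m)
    rw [M.eig', TT_C_mul] at h1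
    have h2 := congrArg (inn (vqt q t) (macQ q t P l)) h1
    rw [inn_sub_right, M.Qeig', inn_C_mul_right, inn_C_mul_right] at h2
    change _ = _ * pp q t P l m at h2
    linear_combination h2
  apply cov_of q t M.q0 M.t0 G l m (M.pp_size l m h)
  rw [ev_eq, ev_eq] at a1 a2
  have q0 := M.q0
  have hne : (1 - q) * (1 - t⁻¹) * (1 - t) * (1 - q⁻¹) * pp q t P l m ≠ 0 := by
    have : 1 - q⁻¹ ≠ 0 := by
      intro h
      apply M.q1
      field_simp at h
      linear_combination -h
    exact mul_ne_zero (mul_ne_zero (mul_ne_zero (mul_ne_zero M.q1 M.s1) M.t1) this) h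
  apply mul_left_cancel₀ hne
  set x := xi q t⁻¹ l
  set y := xi q t⁻¹ m
  set x' := xi q⁻¹ t l
  set y' := xi q⁻¹ t m
  set Y := inn (vqt q t) (macQ q t P l) (TT q t⁻¹ 1 (P m))
  have h3 : (1 - t) * (1 - q⁻¹) * (y' - x') * ((q - 1) * Y) = (q - 1) * (q⁻¹ * (1 - q) * (1 - t⁻¹) * (1 - t) * pp q t P l m) := by
    linear_combination (q - 1) * a2
  rw [a1] at h3
  have hqi : q * q⁻¹ = 1 := mul_inv_cancel₀ q0
  linear_combination h3 + (1 - q) * (1 - t⁻¹) * (1 - t) * pp q t P l m * hqi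

theorem Mac.pp_expand (M : Mac q t P) (m : Partition) : X 0 * P m = ∑ k ∈ Sz (m.size + 1), pp q t P k m • P k :=
  M.expand _ _ (by rw [add_comm]; exact X0_isH.mul (M.isH m))

theorem Mac.cc_expand (M : Mac q t P) (a b : F) (m : Partition) (n : ℕ) :
    FF q a b n * P m = ∑ k ∈ Sz (m.size + n), cc q t P a b k m • P k := by
  rw [M.expand (FF q a b n * P m) (m.size + n) (by rw [add_comm]; exact (FF_isH a b n).mul (M.isH m))]
  refine Finset.sum_congr rfl fun k hk => ?_
  rw [mem_Sz] at hk
  rw [cc, hk, Nat.add_sub_cancel_left]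

theorem TT_smul (p s : F) (k : ℕ) (c : F) (f : Sym F) : TT p s k (c • f) = c • TT p s k f := vop_smul _ _ _ _ _
theorem TT_sum {ι : Type*} (p s : F) (k : ℕ) (S : Finset ι) (f : ι → Sym F) : TT p s k (∑ i ∈ S, f i) = ∑ i ∈ S, TT p s k (f i) := by
  classical
  induction S using Finset.induction_on with
  | empty => simp [TT, vop]
  | insert i S hi ih => rw [Finset.sum_insert hi, Finset.sum_insert hi, TT_add, ih]

theorem Mac.gamma (M : Mac q t P) (m : Partition) : TT q t⁻¹ 1 (P m) =
    ∑ k ∈ Sz (m.size + 1), ((1 - t⁻¹) * (xi q t⁻¹ k - xi q t⁻¹ m) * pp q t P k m) • P k := by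
  have h1 := TT_X_mul q t⁻¹ 0 0 (P m)
  rw [M.eig, mul_left_comm, M.pp_expand, TT_sum] at h1
  simp only [TT_smul, M.eig, zero_add, pow_one] at h1
  have hne : (C (q - 1) : Sym F) ≠ 0 := by
    rw [Ne, C_eq_zero]
    intro h; apply M.q1; linear_combination -h
  apply mul_left_cancel₀ hne
  rw [← sub_eq_iff_eq_add'] at h1
  rw [← h1, Finset.mul_sum, Finset.mul_sum, ← Finset.sum_sub_distrib]
  refine Finset.sum_congr rfl fun k _ => ?_
  rw [ev_eq, ev_eq]
  simp only [smul_eq_C_mul, map_sub, map_mul, map_one]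
  ring

theorem Mac.R2 (M : Mac q t P) (a b : F) (l m : Partition) (n : ℕ) (h : l.size = m.size + n + 1) :
    ∑ k ∈ Sz (m.size + n), pp q t P l k * cc q t P a b k m = ∑ k ∈ Sz (m.size + 1), cc q t P a b l k * pp q t P k m := by
  have h1 : X 0 * (FF q a b n * P m) = FF q a b n * (X 0 * P m) := by ring
  rw [M.cc_expand, M.pp_expand, Finset.mul_sum, Finset.mul_sum] at h1
  have h2 := congrArg (inn (vqt q t) (macQ q t P l)) h1
  rw [inn_sum_right, inn_sum_right] at h2
  simp only [mul_smul_comm, inn_smul_right] at h2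
  convert h2 using 1
  · refine Finset.sum_congr rfl fun k _ => ?_
    rw [pp]; ring
  · refine Finset.sum_congr rfl fun k hk => ?_
    rw [mem_Sz] at hk
    rw [cc, hk, h, show m.size + n + 1 - (m.size + 1) = n by omega]; ring

theorem Mac.R1 (M : Mac q t P) (a b : F) (l m : Partition) (n : ℕ) (h : l.size = m.size + n + 1) :
    (1 - q) * (xi q t⁻¹ l - xi q t⁻¹ m) * cc q t P a b l m =
      a * ∑ k ∈ Sz (m.size + 1), cc q t P a b l k * ((xi q t⁻¹ k - xi q t⁻¹ m) * pp q t P k m)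
      - b * ∑ k ∈ Sz (m.size + n), (xi q t⁻¹ l - xi q t⁻¹ k) * pp q t P l k * cc q t P a b k m := by
  have h1 := FF_rel M.hq t⁻¹ a b n (P m)
  rw [M.cc_expand a b m n, M.eig, TT_sum] at h1
  have h2 := congrArg (inn (vqt q t) (macQ q t P l)) h1
  rw [inn_sub_right, inn_sub_right, M.Qeig, inn_C_mul_right, inn_C_mul_right, mul_left_comm, inn_C_mul_right, inn_sum_right] at h2
  have e1 : inn (vqt q t) (macQ q t P l) (FF q a b (n + 1) * P m) = cc q t P a b l m := by
    rw [cc, h, show m.size + n + 1 - m.size = n + 1 by omega]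
  have e2 : inn (vqt q t) (macQ q t P l) (FF q a b n * TT q t⁻¹ 1 (P m)) =
      ∑ k ∈ Sz (m.size + 1), cc q t P a b l k * ((1 - t⁻¹) * ((xi q t⁻¹ k - xi q t⁻¹ m) * pp q t P k m)) := by
    rw [M.gamma, Finset.mul_sum, inn_sum_right]
    refine Finset.sum_congr rfl fun k hk => ?_
    rw [mem_Sz] at hk
    rw [mul_smul_comm, inn_smul_right, cc, hk, h, show m.size + n + 1 - (m.size + 1) = n by omega]; ring
  have e3 : ∀ k ∈ Sz (m.size + n), inn (vqt q t) (macQ q t P l) (TT q t⁻¹ 1 (cc q t P a b k m • P k)) =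
      (1 - t⁻¹) * ((xi q t⁻¹ l - xi q t⁻¹ k) * pp q t P l k * cc q t P a b k m) := by
    intro k hk
    rw [mem_Sz] at hk
    rw [TT_smul, inn_smul_right, M.gamma, inn_sum_right, Finset.sum_eq_single l]
    · rw [inn_smul_right, M.inn_QP, if_pos rfl]; ring
    · intro j _ hj
      rw [inn_smul_right, M.inn_QP, if_neg (Ne.symm hj), mul_zero]
    · intro hl
      rw [mem_Sz] at hl; omega
  rw [e1, e2, Finset.sum_congr rfl e3, ← Finset.mul_sum, ev_eq, ev_eq] at h2
  simp only [mul_left_comm _ (1 - t⁻¹)] at h2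
  rw [← Finset.mul_sum] at h2
  apply mul_left_cancel₀ M.s1
  linear_combination -h2

theorem Mac.cc_zero (M : Mac q t P) (a b : F) (l m : Partition) (h : l.size ≤ m.size) : cc q t P a b l m = if l = m then 1 else 0 := by
  rw [cc, Nat.sub_eq_zero_of_le h, FF_zero, one_mul, M.inn_QP]

theorem le_trans' (l m k : Partition) (h1 : l ≤ m) (h2 : m ≤ k) : l ≤ k := fun j => le_trans (h1 j) (h2 j)

theorem Mac.cc_supp (M : Mac q t P) (G : Gen q t) (a b : F) (l m : Partition) (h : cc q t P a b l m ≠ 0) : m ≤ l := by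
  obtain ⟨n, hn⟩ : ∃ n, l.size - m.size = n := ⟨_, rfl⟩
  induction n using Nat.strong_induction_on generalizing l m with
  | _ n ih =>
  rcases Nat.eq_zero_or_pos n with h0 | h0
  · rw [M.cc_zero a b l m (by omega)] at h
    have : l = m := by by_contra hc; rw [if_neg hc] at h; exact h rfl
    rw [this]; exact fun j => le_rfl
  · obtain ⟨n', rfl⟩ : ∃ n', n = n' + 1 := ⟨n - 1, by omega⟩
    have hR := M.R1 a b l m n' (by omega)
    by_contra hc
    rw [Finset.sum_eq_zero, Finset.sum_eq_zero] at hR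
    · rw [mul_zero, mul_zero, sub_zero] at hR
      have : xi q t⁻¹ l - xi q t⁻¹ m ≠ 0 := by
        intro hx
        have := xi_inj q t M.q0 M.t0 G l m (by linear_combination hx)
        rw [this] at hn; omega
      exact mul_ne_zero (mul_ne_zero M.q1 this) h hR
    · intro k hk
      rw [mem_Sz] at hk
      by_contra h2
      have h3 := right_ne_zero_of_mul h2
      have h4 := right_ne_zero_of_mul (left_ne_zero_of_mul h2)
      exact hc (le_trans' _ _ _ (ih n' (by omega) k m h3 (by omega)) (M.pp_cov G l k h4).2.1)
    · intro k hk
      rw [mem_Sz] at hk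
      by_contra h2
      have h3 := left_ne_zero_of_mul h2
      have h4 := right_ne_zero_of_mul (right_ne_zero_of_mul h2)
      exact hc (le_trans' _ _ _ (M.pp_cov G k m h4).2.1 (ih n' (by omega) l k h3 (by omega)))

end Mat

/-! ### The commuting kernels and the summation -/

section Ker
open MvPolynomial
variable [CharZero F]
variable {q t : F} {P : Partition → Sym F}

/-- partitions of size at most `N` -/
def TN (N : ℕ) : Finset Partition := (Finset.range (N + 1)).biUnion Sz

theorem mem_TN (N : ℕ) (l : Partition) : l ∈ TN N ↔ l.size ≤ N := by
  simp [TN, mem_Sz, Nat.lt_succ_iff]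

/-- the kernel -/
def KK (q t : F) (P : Partition → Sym F) (a b : F) (l m : Partition) : F :=
  qtPoch q t a m / qtPoch q t b l * cc q t P a b l m

theorem Mac.KK_rel (M : Mac q t P) (G : Gen q t) (a b : F) (hb : ∀ l, qtPoch q t b l ≠ 0)
    (l m : Partition) (n : ℕ) (h : l.size = m.size + n + 1) :
    (1 - q) * (xi q t⁻¹ l - xi q t⁻¹ m) * KK q t P a b l m =
      ∑ k ∈ Sz (m.size + n), pp q t P l k * KK q t P a b k m - ∑ k ∈ Sz (m.size + 1), KK q t P a b l k * pp q t P k m := by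
  have h1 := M.R1 a b l m n h
  have h2 := M.R2 a b l m n h
  have e1 : ∀ k, pp q t P l k * KK q t P a b k m = qtPoch q t a m / qtPoch q t b l *
      (pp q t P l k * cc q t P a b k m - b * ((xi q t⁻¹ l - xi q t⁻¹ k) * pp q t P l k * cc q t P a b k m)) := by
    intro k
    by_cases hp : pp q t P l k = 0
    · rw [hp]; ring
    have := (M.pp_cov G l k hp).poch q t b
    have hx : (1 - b * (xi q t⁻¹ l - xi q t⁻¹ k)) ≠ 0 := by
      intro hx
      apply hb l
      rw [this, hx, mul_zero]
    have hk := hb k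
    rw [KK, this, show pp q t P l k * cc q t P a b k m - b * ((xi q t⁻¹ l - xi q t⁻¹ k) * pp q t P l k * cc q t P a b k m) =
      pp q t P l k * cc q t P a b k m * (1 - b * (xi q t⁻¹ l - xi q t⁻¹ k)) by ring]
    generalize (1 - b * (xi q t⁻¹ l - xi q t⁻¹ k)) = y at hx ⊢
    field_simp
  have e2 : ∀ k, KK q t P a b l k * pp q t P k m = qtPoch q t a m / qtPoch q t b l *
      (cc q t P a b l k * pp q t P k m - a * (cc q t P a b l k * ((xi q t⁻¹ k - xi q t⁻¹ m) * pp q t P k m))) := by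
    intro k
    by_cases hp : pp q t P k m = 0
    · rw [hp]; ring
    rw [KK, (M.pp_cov G k m hp).poch q t a]
    ring
  simp only [e1, e2]
  rw [← Finset.mul_sum, ← Finset.mul_sum, Finset.sum_sub_distrib, Finset.sum_sub_distrib, ← Finset.mul_sum, ← Finset.mul_sum, h2, KK]
  linear_combination qtPoch q t a m / qtPoch q t b l * h1

/-- matrix of the kernel -/
def MK (N : ℕ) (A : Partition → Partition → F) : Matrix (TN N) (TN N) F := fun l m => A l.1 m.1

/-- the matrix commuting with all kernels -/
def MZ (q t : F) (P : Partition → Sym F) (N : ℕ) : Matrix (TN N) (TN N) F :=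
  Matrix.diagonal (fun l => (1 - q) * xi q t⁻¹ l.1) - MK N (pp q t P)

theorem sum_TN (N n : ℕ) (hn : n ≤ N) (f : Partition → F) (hf : ∀ k, f k ≠ 0 → k.size = n) :
    ∑ k : TN N, f k.1 = ∑ k ∈ Sz n, f k := by
  rw [Finset.sum_coe_sort (TN N) f]
  symm
  apply Finset.sum_subset
  · intro k hk
    rw [mem_Sz] at hk
    rw [mem_TN]; omega
  · intro k _ hk
    by_contra hc
    exact hk ((mem_Sz n k).mpr (hf k hc))

theorem MZ_entry (N : ℕ) (A : Partition → Partition → F) (l m : TN N) :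
    (MK N A * MZ q t P N - MZ q t P N * MK N A) l m =
      -((1 - q) * (xi q t⁻¹ l.1 - xi q t⁻¹ m.1) * A l m) - ∑ k : TN N, A l k * pp q t P k m + ∑ k : TN N, pp q t P l k * A k m := by
  rw [MZ, mul_sub, sub_mul, Matrix.sub_apply, Matrix.sub_apply, Matrix.sub_apply, Matrix.mul_diagonal, Matrix.diagonal_mul,
    Matrix.mul_apply, Matrix.mul_apply]
  simp only [MK]
  ring

theorem KK_ne_size (M : Mac q t P) (a b : F) (l m : Partition) (h : l.size ≤ m.size) (hlm : l ≠ m) : KK q t P a b l m = 0 := by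
  rw [KK, M.cc_zero a b l m h, if_neg hlm, mul_zero]

theorem Mac.MK_comm (M : Mac q t P) (G : Gen q t) (a b : F) (hb : ∀ l, qtPoch q t b l ≠ 0) (N : ℕ) :
    MK N (KK q t P a b) * MZ q t P N = MZ q t P N * MK N (KK q t P a b) := by
  rw [← sub_eq_zero]
  ext l m
  rw [MZ_entry, Matrix.zero_apply]
  have hl := (mem_TN N l.1).mp l.2
  have hm := (mem_TN N m.1).mp m.2
  rcases le_or_gt l.1.size m.1.size with h | h
  · rw [Finset.sum_eq_zero, Finset.sum_eq_zero]
    · by_cases hlm : l.1 = m.1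
      · rw [hlm]; ring
      · rw [KK_ne_size M a b _ _ h hlm]; ring
    · intro k _
      by_contra hc
      have h1 := M.pp_size _ _ (left_ne_zero_of_mul hc)
      apply right_ne_zero_of_mul hc
      apply KK_ne_size M
      · omega
      · intro hk; rw [hk] at h1; omega
    · intro k _
      by_contra hc
      have h1 := M.pp_size _ _ (right_ne_zero_of_mul hc)
      apply left_ne_zero_of_mul hc
      apply KK_ne_size M
      · omega
      · intro hk; rw [hk] at h; omega
  · obtain ⟨n, hn⟩ : ∃ n, l.1.size = m.1.size + n + 1 := ⟨l.1.size - m.1.size - 1, by omega⟩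
    rw [M.KK_rel G a b hb l.1 m.1 n hn,
      sum_TN N (m.1.size + 1) (by omega) (fun k => KK q t P a b l.1 k * pp q t P k m.1) (fun k hk => M.pp_size _ _ (right_ne_zero_of_mul hk)),
      sum_TN N (m.1.size + n) (by omega) (fun k => pp q t P l.1 k * KK q t P a b k m.1) (fun k hk => by
        have := M.pp_size _ _ (left_ne_zero_of_mul hk); omega)]
    ring

theorem Mac.comm_unique (M : Mac q t P) (G : Gen q t) (N : ℕ) (A : Partition → Partition → F)
    (hA : MK N A * MZ q t P N = MZ q t P N * MK N A) (h0 : ∀ l m : TN N, l.1.size ≤ m.1.size → A l m = 0) (l m : TN N) : A l m = 0 := by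
  obtain ⟨n, hn⟩ : ∃ n, l.1.size - m.1.size = n := ⟨_, rfl⟩
  induction n using Nat.strong_induction_on generalizing l m with
  | _ n ih =>
  rcases le_or_gt l.1.size m.1.size with h | h
  · exact h0 l m h
  · have h1 := MZ_entry (q := q) (t := t) (P := P) N A l m
    rw [hA, sub_self, Matrix.zero_apply, Finset.sum_eq_zero, Finset.sum_eq_zero] at h1
    · have hx : xi q t⁻¹ l.1 - xi q t⁻¹ m.1 ≠ 0 := by
        intro hx
        have := xi_inj q t M.q0 M.t0 G l.1 m.1 (by linear_combination hx)
        rw [this] at h; omega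
      have h2 : (1 - q) * (xi q t⁻¹ l.1 - xi q t⁻¹ m.1) * A l m = 0 := by linear_combination h1
      exact (mul_eq_zero.mp h2).resolve_left (mul_ne_zero M.q1 hx)
    · intro k _
      by_contra hc
      have h3 := M.pp_size _ _ (left_ne_zero_of_mul hc)
      exact right_ne_zero_of_mul hc (ih (k.1.size - m.1.size) (by omega) k m rfl)
    · intro k _
      by_contra hc
      have h3 := M.pp_size _ _ (right_ne_zero_of_mul hc)
      exact left_ne_zero_of_mul hc (ih (l.1.size - k.1.size) (by omega) l k rfl)

theorem Mac.KK_mul (M : Mac q t P) (G : Gen q t) (a b c : F) (hb : ∀ l, qtPoch q t b l ≠ 0) (hc : ∀ l, qtPoch q t c l ≠ 0)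
    (N : ℕ) (l m : Partition) (hl : l.size ≤ N) (hm : m.size ≤ N) :
    ∑ k ∈ TN N, KK q t P a b l k * KK q t P b c k m = KK q t P a c l m := by
  set D : Partition → Partition → F := fun l m => (∑ k ∈ TN N, KK q t P a b l k * KK q t P b c k m) - KK q t P a c l m with hD
  have hMD : MK N D = MK N (KK q t P a b) * MK N (KK q t P b c) - MK N (KK q t P a c) := by
    ext x y
    rw [Matrix.sub_apply, Matrix.mul_apply]
    simp only [MK, hD]
    rw [Finset.sum_coe_sort (TN N) (fun k => KK q t P a b x.1 k * KK q t P b c k y.1)]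
  have h1 := M.MK_comm G a b hb N
  have h2 := M.MK_comm G b c hc N
  have h3 := M.MK_comm G a c hc N
  have hz := M.comm_unique G N D (by rw [hMD, sub_mul, mul_sub, mul_assoc, h2, ← mul_assoc, h1, h3, mul_assoc]) (by
    intro x y hxy
    simp only [hD]
    by_cases he : x.1 = y.1
    · rw [Finset.sum_eq_single y.1]
      · rw [he]
        simp only [KK, M.cc_zero _ _ _ _ le_rfl, if_pos]
        have := hb y.1
        field_simp
        ring
      · intro k _ hk
        rcases le_or_gt k.size y.1.size with h | h
        · rw [KK_ne_size M b c k y.1 h hk, mul_zero]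
        · rw [KK_ne_size M a b x.1 k (by omega) (by intro h'; rw [← h'] at h; omega), zero_mul]
      · intro h; exact absurd y.2 h
    · rw [KK_ne_size M a c _ _ hxy he, sub_zero]
      apply Finset.sum_eq_zero
      intro k _
      rcases eq_or_ne k y.1 with hk | hk
      · rw [hk, KK_ne_size M a b _ _ hxy he, zero_mul]
      · rcases le_or_gt k.size y.1.size with h | h
        · rw [KK_ne_size M b c k y.1 h hk, mul_zero]
        · rw [KK_ne_size M a b x.1 k (by omega) (by intro h'; rw [← h'] at h; omega), zero_mul]) ⟨l, (mem_TN N l).mpr hl⟩ ⟨m, (mem_TN N m).mpr hm⟩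
  exact sub_eq_zero.mp hz

theorem zev_isH (α : ℕ → F) (f : Sym F) (n : ℕ) (hf : IsH f n) : (zev α f).coeff n = eval α f := by
  rw [f.as_sum, map_sum, map_sum, Polynomial.finset_sum_coeff]
  refine Finset.sum_congr rfl fun d hd => ?_
  have : wt d = n := by
    rw [← wt_eq_weight]; exact hf (mem_support_iff.mp hd)
  rw [zev_monomial, Polynomial.coeff_C_mul, Polynomial.coeff_X_pow, if_pos this.symm, eval_monomial, mul_one]

theorem Mac.pleth (M : Mac q t P) (a b : F) (l m : Partition) : plethAB t a b (skewQ q t P l m) = cc q t P a b l m := by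
  have hz : ∀ n : Partition, innerQT q t (macQ q t P l) (P m * P n) • macQ q t P n ≠ 0 → l.size = m.size + n.size := by
    intro n hn
    by_contra hc
    apply hn
    rw [innerQT_eq]
    have := inn_isH (vqt q t) _ _ _ _ (M.Q_isH l) ((M.isH m).mul (M.isH n)) hc
    change inn (vqt q t) _ _ • _ = _
    rw [this, zero_smul]
  have hS : skewQ q t P l m = ∑ n ∈ Sz (l.size - m.size), inn (vqt q t) (macQ q t P l) (P m * P n) • macQ q t P n := by
    rw [skewQ, finsum_eq_sum_of_support_subset (s := Sz (l.size - m.size))]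
    · refine Finset.sum_congr rfl fun n _ => ?_
      rw [innerQT_eq]; rfl
    · intro n hn
      have := hz n hn
      rw [Finset.mem_coe, mem_Sz]; omega
  have h1 : ∀ n ∈ Sz (l.size - m.size), plethAB t a b (macQ q t P n) = inn (vqt q t) (macQ q t P n) (FF q a b (l.size - m.size)) := by
    intro n hn
    rw [mem_Sz] at hn
    rw [plethAB, ← zev_isH _ _ _ (M.Q_isH n), inn_comm, FF, hn, inn_gen]
    intro k
    have := M.hq k
    have := M.ht k
    rw [vqt]
    field_simp
  rw [hS, cc]
  conv_rhs => rw [M.expand (FF q a b (l.size - m.size)) _ (FF_isH a b _), Finset.sum_mul, inn_sum_right]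
  rw [plethAB, map_sum]
  refine Finset.sum_congr rfl fun n hn => ?_
  rw [smul_mul_assoc, inn_smul_right, ← h1 n hn, plethAB, smul_eq_C_mul, map_mul, eval_C, mul_comm (P n)]
  ring

theorem Mac.hs (M : Mac q t P) (l m : Partition) : hsM q t P l m = cc q t P 1 t l m := by
  rw [← M.pleth, hsM, plethAB]
  congr 2
  funext n
  rw [one_pow, div_self (M.ht n)]

theorem cc_rescale (a b z : F) (l m : Partition) : cc q t P (z * a) (z * b) l m = z ^ (l.size - m.size) * cc q t P a b l m := by
  rw [cc, FF_rescale, mul_assoc, inn_C_mul_right, cc]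

theorem size_mono (l m : Partition) (h : l ≤ m) : l.size ≤ m.size := by
  rw [← card_cells, ← card_cells]
  exact Finset.card_le_card ((cells_subset m l).mpr h)

theorem Mac.final (M : Mac q t P) (G : Gen q t) (a : F) (a0 : a ≠ 0) (hb : ∀ l, qtPoch q t (a / q) l ≠ 0)
    (hc : ∀ l, qtPoch q t (a * t) l ≠ 0) (lam nu : Partition) :
    (∑ᶠ (mu : Partition) (_ : nu ≤ mu ∧ mu ≤ lam),
        (qtPoch q t a mu / qtPoch q t (a * t) mu) *
          (-1 : F) ^ (lam.size - mu.size) * vsM q t P lam mu *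
          plethAB t 1 (q * t) (skewQ q t P mu nu)) =
      ((qtPoch q t a nu * qtPoch q t (a / q) lam) /
          (qtPoch q t (a / q) nu * qtPoch q t (a * t) lam)) *
        q ^ ((lam.size : ℤ) - (nu.size : ℤ)) * hsM q t P lam nu := by
  classical
  have q0 := M.q0
  by_cases hle : nu ≤ lam
  swap
  · rw [M.hs, show cc q t P 1 t lam nu = 0 by
      by_contra h; exact hle (M.cc_supp G _ _ _ _ h), mul_zero]
    apply finsum_eq_zero_of_forall_eq_zero
    intro mu
    rw [finsum_eq_if, if_neg (fun h => hle (le_trans' _ _ _ h.1 h.2))]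
  have hs := size_mono _ _ hle
  have hN := M.KK_mul G a (a / q) (a * t) hb hc lam.size lam nu le_rfl hs
  have key : ∀ mu, (if nu ≤ mu ∧ mu ≤ lam then (qtPoch q t a mu / qtPoch q t (a * t) mu) *
          (-1 : F) ^ (lam.size - mu.size) * vsM q t P lam mu *
          plethAB t 1 (q * t) (skewQ q t P mu nu) else 0) =
      (q / a) ^ (lam.size - nu.size) * (qtPoch q t (a / q) lam / qtPoch q t (a / q) nu) * 
        (KK q t P a (a / q) lam mu * KK q t P (a / q) (a * t) mu nu) := by
    intro mu
    split_ifs with h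
    · have s1 := size_mono _ _ h.1
      have s2 := size_mono _ _ h.2
      have hv : (-1 : F) ^ (lam.size - mu.size) * vsM q t P lam mu = cc q t P q 1 lam mu := by
        rw [vsM, M.pleth, ← Nat.cast_sub s2, zpow_natCast, ← mul_assoc, ← mul_pow]
        simp
      have e1 : cc q t P q 1 lam mu = (q / a) ^ (lam.size - mu.size) * cc q t P a (a / q) lam mu := by
        rw [← cc_rescale]
        congr 1 <;> field_simp
      have e2 : cc q t P 1 (q * t) mu nu = (q / a) ^ (mu.size - nu.size) * cc q t P (a / q) (a * t) mu nu := by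
        rw [← cc_rescale]
        congr 1 <;> field_simp
      have e3 : (q / a) ^ (lam.size - nu.size) = (q / a) ^ (lam.size - mu.size) * (q / a) ^ (mu.size - nu.size) := by
        rw [← pow_add]; congr 1; omega
      rw [mul_assoc (qtPoch q t a mu / qtPoch q t (a * t) mu), hv, M.pleth, e1, e2, e3, KK, KK]
      have h1 := hb lam
      have h2 := hb nu
      have h3 := hc mu
      field_simp
    · rw [KK, KK]
      by_cases h1 : cc q t P a (a / q) lam mu = 0
      · rw [h1]; ring
      by_cases h2 : cc q t P (a / q) (a * t) mu nu = 0
      · rw [h2]; ring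
      exact absurd ⟨M.cc_supp G _ _ _ _ h2, M.cc_supp G _ _ _ _ h1⟩ h
  have hfs : ∀ mu, (∑ᶠ (_ : nu ≤ mu ∧ mu ≤ lam), (qtPoch q t a mu / qtPoch q t (a * t) mu) *
          (-1 : F) ^ (lam.size - mu.size) * vsM q t P lam mu *
          plethAB t 1 (q * t) (skewQ q t P mu nu)) = if nu ≤ mu ∧ mu ≤ lam then (qtPoch q t a mu / qtPoch q t (a * t) mu) *
          (-1 : F) ^ (lam.size - mu.size) * vsM q t P lam mu *
          plethAB t 1 (q * t) (skewQ q t P mu nu) else 0 := fun mu => finsum_eq_if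
  simp only [hfs]
  rw [finsum_eq_sum_of_support_subset (s := TN lam.size)]
  · simp only [key]
    rw [← Finset.mul_sum, hN, KK, M.hs]
    have e : cc q t P 1 t lam nu = a⁻¹ ^ (lam.size - nu.size) * cc q t P a (a * t) lam nu := by
      rw [← cc_rescale]
      congr 1 <;> field_simp
    rw [e, ← Nat.cast_sub hs, zpow_natCast, div_pow, inv_pow]
    have h1 := hb nu
    have h2 := hc lam
    field_simp
  · intro mu hmu
    rw [Function.mem_support] at hmu
    rw [Finset.mem_coe, mem_TN]
    split_ifs at hmu with h
    · exact size_mono _ _ h.2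
    · exact absurd rfl hmu

end Ker

section Inst

/-- embedding of rational functions in Laurent series -/
def toLS (K : Type*) [Field K] : RatFunc K →+* LaurentSeries K :=
  IsFractionRing.lift (A := Polynomial K) (K := RatFunc K) (g := algebraMap (Polynomial K) (LaurentSeries K))
    (Polynomial.algebraMap_hahnSeries_injective ℤ)

theorem toLS_poly (K : Type*) [Field K] (p : Polynomial K) :
    toLS K (algebraMap (Polynomial K) (RatFunc K) p) = algebraMap (Polynomial K) (LaurentSeries K) p :=
  IsFractionRing.lift_algebraMap _ p

theorem toLS_X (K : Type*) [Field K] : toLS K RatFunc.X = HahnSeries.single 1 1 := by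
  rw [← RatFunc.algebraMap_X, toLS_poly]
  simp

theorem toLS_C (K : Type*) [Field K] (c : K) : toLS K (RatFunc.C c) = HahnSeries.C c := by
  rw [← RatFunc.algebraMap_C, toLS_poly]
  simp

/-- constant term of a rational function expanded as a Laurent series -/
def ctR (K : Type*) [Field K] : RatFunc K →+ K where
  toFun f := (toLS K f).coeff 0
  map_zero' := by simp
  map_add' f g := by simp

theorem ctR_C_X (K : Type*) [Field K] (c : K) (i : ℤ) :
    ctR K (RatFunc.C c * RatFunc.X ^ i) = if i = 0 then c else 0 := by
  show (toLS K _).coeff 0 = _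
  rw [map_mul, map_zpow₀, toLS_X, toLS_C, ← RatFunc.single_zpow, HahnSeries.C_mul_eq_smul, HahnSeries.coeff_smul, HahnSeries.coeff_single]
  split_ifs with h1 h2 <;> simp_all

theorem ctR_C (K : Type*) [Field K] (c : K) : ctR K (RatFunc.C c) = c := by
  have := ctR_C_X K c 0
  simpa using this

instance : CharZero F1 := inferInstance
instance : CharZero F2 := charZero_of_injective_algebraMap (algebraMap F1 F2).injective
instance : CharZero F3 := charZero_of_injective_algebraMap (algebraMap F2 F3).injective

theorem gen3 : Gen q3 t3 := by
  refine ⟨((ctR ℚ).comp ((ctR F1).comp (ctR F2))).toRatLinearMap, fun i j => ?_⟩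
  have e : q3 ^ i * t3 ^ j = RatFunc.C (RatFunc.C (t1 ^ j) * RatFunc.X ^ i) := by
    rw [q3, t3, q2, t2, map_mul, map_zpow₀, map_zpow₀, map_zpow₀, mul_comm]
  show ctR ℚ (ctR F1 (ctR F2 (q3 ^ i * t3 ^ j))) = _
  rw [e, ctR_C, ctR_C_X]
  have h2 := ctR_C_X ℚ 1 j
  rw [map_one, one_mul] at h2
  by_cases hi : i = 0
  · simp only [hi, if_true, true_and]
    exact h2
  · simp [hi]

theorem one_sub_a3 (w : F2) : 1 - a3 * RatFunc.C w ≠ 0 := by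
  intro h
  have h1 := congrArg (ctR F2) h
  have h2 := ctR_C_X F2 w 1
  have h3 := ctR_C F2 1
  rw [zpow_one, mul_comm] at h2
  rw [map_one] at h3
  rw [map_sub, map_zero, a3, h2, h3] at h1
  simp at h1

theorem poch3 (w : F2) (l : Partition) : qtPoch q3 t3 (a3 * RatFunc.C w) l ≠ 0 := by
  rw [qtPoch_eq, Finset.prod_ne_zero_iff]
  intro x _
  have : a3 * RatFunc.C w * (q3 ^ x.2 * t3⁻¹ ^ x.1) = a3 * RatFunc.C (w * (q2 ^ x.2 * t2⁻¹ ^ x.1)) := by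
    rw [q3, t3, map_mul, map_mul, map_pow, map_pow, map_inv₀, mul_assoc]
  rw [this]
  exact one_sub_a3 _

theorem q3_ne : q3 ≠ 0 := by
  rw [q3, q2]
  exact (map_ne_zero _).mpr RatFunc.X_ne_zero

theorem t3_ne : t3 ≠ 0 := by
  rw [t3, t2, t1]
  exact (map_ne_zero _).mpr ((map_ne_zero _).mpr RatFunc.X_ne_zero)

theorem hq3 (n : ℕ) : 1 - q3 ^ (n + 1) ≠ 0 := by
  obtain ⟨g, hg⟩ := gen3
  intro h
  have h1 := hg 0 0
  have h2 := hg (n + 1 : ℕ) 0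
  rw [zpow_natCast, zpow_zero, mul_one, ← sub_eq_zero.mp h, if_neg (by omega)] at h2
  rw [zpow_zero, zpow_zero, mul_one, h2] at h1
  simp at h1

theorem ht3 (n : ℕ) : 1 - t3 ^ (n + 1) ≠ 0 := by
  obtain ⟨g, hg⟩ := gen3
  intro h
  have h1 := hg 0 0
  have h2 := hg 0 (n + 1 : ℕ)
  rw [zpow_natCast, zpow_zero, one_mul, ← sub_eq_zero.mp h, if_neg (by omega)] at h2
  rw [zpow_zero, zpow_zero, mul_one, h2] at h1
  simp at h1

end Inst

end Parts

/-- A parameter-dependent summation relating `vs`, `sk`-type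
evaluations and `hs`: for all partitions `λ, ν`,
`∑_μ ((a)_μ/(at)_μ) (-1)^{|λ|-|μ|} vs_{λ/μ}(q,t) Q_{μ/ν}((1-qt)/(1-t))
  = ((a)_ν (a/q)_λ)/((a/q)_ν (at)_λ) q^{|λ|-|ν|} hs_{λ/ν}(q,t)`,
the sum over partitions `μ` with `ν ⊆ μ ⊆ λ`. -/
theorem vs_sk_sum_with_parameter
    (P : Partition → Sym F3) (hP : IsMacdonald q3 t3 P) (lam nu : Partition) :
    (∑ᶠ (mu : Partition) (_ : nu ≤ mu ∧ mu ≤ lam),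
        (qtPoch q3 t3 a3 mu / qtPoch q3 t3 (a3 * t3) mu) *
          (-1 : F3) ^ (lam.size - mu.size) * vsM q3 t3 P lam mu *
          plethAB t3 1 (q3 * t3) (skewQ q3 t3 P mu nu)) =
      ((qtPoch q3 t3 a3 nu * qtPoch q3 t3 (a3 / q3) lam) /
          (qtPoch q3 t3 (a3 / q3) nu * qtPoch q3 t3 (a3 * t3) lam)) *
        q3 ^ ((lam.size : ℤ) - (nu.size : ℤ)) * hsM q3 t3 P lam nu := by
  refine Mac.final ⟨q3_ne, t3_ne, hq3, ht3, hP⟩ gen3 a3 RatFunc.X_ne_zero (fun l => ?_) (fun l => poch3 t2 l) lam nu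
  have h := poch3 q2⁻¹ l
  rw [map_inv₀] at h
  rw [div_eq_mul_inv]
  exact h

end SkewPieriFormalization
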